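/- arXiv:2508.13466 — 4 statements merged into one kernel-verified Lean document; each statement's English description precedes it below -/
import Mathlib

section
/- Let T be a finite tree on n vertices and let T' be a subtree of T on n' vertices (a connected subgraph of T). Then the Laplacian eigenvalues satisfy λ_i(T) ≤ λ_i(T') for every i = 1, 2, …, n'. -/
open scoped Classical

noncomputable section

/-- The `k`-th smallest root (1-based, with multiplicity) of the characteristic polynomial
of a real matrix.  For a symmetric matrix these are exactly its eigenvalues listed
in nondecreasing order. -/
def kthEig {ι : Type*} [Fintype ι] [DecidableEq ι] (M : Matrix ι ι ℝ) (k : ℕ) : ℝ :=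
  (M.charpoly.roots.sort (· ≤ ·)).getD (k - 1) 0

/-- The `k`-th smallest Laplacian eigenvalue (1-based); `lapEig G 2` is the algebraic
connectivity. -/
def lapEig {V : Type*} [Fintype V] (G : SimpleGraph V) (k : ℕ) : ℝ :=
  kthEig (SimpleGraph.lapMatrix ℝ G) k

/-- The Steklov (Dirichlet-to-Neumann) matrix of a graph with boundary `B`:
the Schur complement of the interior block of the Laplacian, i.e. the matrix of the map
sending `f : B → ℝ` to the normal derivative of its harmonic extension. -/
def steklovMatrix {V : Type*} [Fintype V] (G : SimpleGraph V) (B : Set V) :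
    Matrix B B ℝ :=
  let L := SimpleGraph.lapMatrix ℝ G
  L.submatrix (Subtype.val : B → V) (Subtype.val : B → V) -
    L.submatrix (Subtype.val : B → V) (Subtype.val : (Bᶜ : Set V) → V) *
      (L.submatrix (Subtype.val : (Bᶜ : Set V) → V) (Subtype.val : (Bᶜ : Set V) → V))⁻¹ *
      L.submatrix (Subtype.val : (Bᶜ : Set V) → V) (Subtype.val : B → V)

/-- The `k`-th smallest Steklov eigenvalue (1-based). -/
def steklovEig {V : Type*} [Fintype V] (G : SimpleGraph V) (B : Set V) (k : ℕ) : ℝ :=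
  kthEig (steklovMatrix G B) k

/-- The set of leaves (vertices of degree 1) of a graph. -/
def leaves {V : Type*} (G : SimpleGraph V) : Set V := {v | (G.neighborSet v).ncard = 1}

/-- A set of edges is a matching if the edges belong to the graph and are pairwise
vertex-disjoint. -/
def IsMatchingSet {V : Type*} (G : SimpleGraph V) (s : Set (Sym2 V)) : Prop :=
  s ⊆ G.edgeSet ∧ s.Pairwise fun e f => ∀ v, v ∈ e → v ∉ f

/-- The matching number of a graph: the maximum size of a matching. -/
def matchingNumber {V : Type*} [Fintype V] (G : SimpleGraph V) : ℕ :=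
  sSup {n | ∃ s : Set (Sym2 V), IsMatchingSet G s ∧ s.ncard = n}

/-- The star graph on `n` vertices. -/
def starGraph (n : ℕ) : SimpleGraph (Fin n) :=
  SimpleGraph.fromRel (fun i _ => i.val = 0)

/-- Vertices of the spider graph with two leg lengths. -/
abbrev Spider2V (p₁ p₂ ℓ₁ ℓ₂ : ℕ) := Option ((Fin p₁ × Fin ℓ₁) ⊕ (Fin p₂ × Fin ℓ₂))

def spider2Rel (p₁ p₂ ℓ₁ ℓ₂ : ℕ) :
    Spider2V p₁ p₂ ℓ₁ ℓ₂ → Spider2V p₁ p₂ ℓ₁ ℓ₂ → Prop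
  | none, some (Sum.inl (_, j)) => j.val = 0
  | none, some (Sum.inr (_, j)) => j.val = 0
  | some (Sum.inl (i, j)), some (Sum.inl (i', j')) => i = i' ∧ j'.val = j.val + 1
  | some (Sum.inr (i, j)), some (Sum.inr (i', j')) => i = i' ∧ j'.val = j.val + 1
  | _, _ => False

/-- The spider graph `Sp_{p₁,p₂;ℓ₁,ℓ₂}`: `p₁` paths of length `ℓ₁` and `p₂` paths of
length `ℓ₂`, with one endpoint of each path identified to a common center (`none`). -/
def spider2 (p₁ p₂ ℓ₁ ℓ₂ : ℕ) : SimpleGraph (Spider2V p₁ p₂ ℓ₁ ℓ₂) :=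
  SimpleGraph.fromRel (spider2Rel p₁ p₂ ℓ₁ ℓ₂)

/-- Vertices of the crab graph. -/
abbrev CrabV (b₁ b₂ r : ℕ) := Option (Fin b₁ × Fin r) ⊕ Option (Fin b₂ × Fin r)

def crabRel (b₁ b₂ r : ℕ) : CrabV b₁ b₂ r → CrabV b₁ b₂ r → Prop
  | Sum.inl none, Sum.inr none => True
  | Sum.inl none, Sum.inl (some (_, j)) => j.val = 0
  | Sum.inl (some (i, j)), Sum.inl (some (i', j')) => i = i' ∧ j'.val = j.val + 1
  | Sum.inr none, Sum.inr (some (_, j)) => j.val = 0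
  | Sum.inr (some (i, j)), Sum.inr (some (i', j')) => i = i' ∧ j'.val = j.val + 1
  | _, _ => False

/-- The crab graph `CG_{b₁,b₂;r}`: two spiders `Sp_{b₁;r}` and `Sp_{b₂;r}` with their
centers joined by an edge. -/
def crab (b₁ b₂ r : ℕ) : SimpleGraph (CrabV b₁ b₂ r) :=
  SimpleGraph.fromRel (crabRel b₁ b₂ r)


open Matrix

theorem List.Pairwise.getElem_le_iff_lt_countP {l : List ℝ} (hl : l.Pairwise (· ≤ ·)) {k : ℕ}
    (hk : k < l.length) (c : ℝ) : l[k] ≤ c ↔ k < l.countP (· ≤ c) := by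
  constructor
  · intro h
    have h1 : (l.take (k + 1)).countP (· ≤ c) = (l.take (k + 1)).length := by
      rw [List.countP_eq_length]
      intro a ha
      obtain ⟨j, hj, rfl⟩ := List.mem_take_iff_getElem.1 ha
      have hjk : j ≤ k := by omega
      have hle : l[j] ≤ l[k] := by
        rcases hjk.eq_or_lt with rfl | hlt
        · exact le_rfl
        · exact List.pairwise_iff_getElem.1 hl j k _ hk hlt
      simpa using hle.trans h
    have h2 := (List.take_sublist (k + 1) l).countP_le (p := (· ≤ c))
    rw [h1, List.length_take] at h2
    omega
  · intro h
    by_contra! hc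
    have h1 : (l.drop k).countP (· ≤ c) = 0 := by
      rw [List.countP_eq_zero]
      intro a ha
      obtain ⟨j, hj, rfl⟩ := List.mem_drop_iff_getElem.1 ha
      have hle : l[k] ≤ l[k + j] := by
        rcases Nat.eq_zero_or_pos j with rfl | hpos
        · simp
        · exact List.pairwise_iff_getElem.1 hl k (k + j) hk _ (by omega)
      simpa using hc.trans_le hle
    have h2 : l.countP (· ≤ c) = (l.take k).countP (· ≤ c) + (l.drop k).countP (· ≤ c) := by
      rw [← List.countP_append, List.take_append_drop]
    have h3 := List.countP_le_length (p := (· ≤ c)) (l := l.take k)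
    rw [List.length_take] at h3
    omega

namespace Matrix.IsHermitian

variable {ι κ : Type*} [Fintype ι] [DecidableEq ι] [Fintype κ] [DecidableEq κ]

theorem card_roots_charpoly_real {M : Matrix ι ι ℝ} (hM : M.IsHermitian) :
    M.charpoly.roots.card = Fintype.card ι := by
  simp [hM.roots_charpoly_eq_eigenvalues]

/-- The `k`-th smallest eigenvalue of a symmetric matrix is at most `c` iff at least `k`
eigenvalues are at most `c`. -/
theorem kthEig_le_iff {M : Matrix ι ι ℝ} (hM : M.IsHermitian) {k : ℕ} (hk1 : 1 ≤ k)
    (hk2 : k ≤ Fintype.card ι) (c : ℝ) :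
    kthEig M k ≤ c ↔ k ≤ Fintype.card {j // hM.eigenvalues j ≤ c} := by
  have hlen : k - 1 < (M.charpoly.roots.sort (· ≤ ·)).length := by
    rw [Multiset.length_sort, hM.card_roots_charpoly_real]
    omega
  have hcount : (M.charpoly.roots.sort (· ≤ ·)).countP (· ≤ c) =
      Fintype.card {j // hM.eigenvalues j ≤ c} := by
    rw [← Multiset.coe_countP, Multiset.sort_eq, hM.roots_charpoly_eq_eigenvalues,
      Multiset.countP_map, Fintype.card_subtype]
    rfl
  rw [kthEig, List.getD_eq_getElem _ _ hlen,
    (Multiset.pairwise_sort _ _).getElem_le_iff_lt_countP hlen, hcount]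
  omega

theorem exists_eigenvalues_eq_kthEig {M : Matrix ι ι ℝ} (hM : M.IsHermitian) {k : ℕ} (hk1 : 1 ≤ k)
    (hk2 : k ≤ Fintype.card ι) : ∃ j, hM.eigenvalues j = kthEig M k := by
  have hlen : k - 1 < (M.charpoly.roots.sort (· ≤ ·)).length := by
    rw [Multiset.length_sort, hM.card_roots_charpoly_real]
    omega
  have hmem : kthEig M k ∈ M.charpoly.roots := by
    rw [kthEig, List.getD_eq_getElem _ _ hlen, ← Multiset.mem_sort (r := (· ≤ ·))]
    exact List.getElem_mem hlen
  simpa [hM.roots_charpoly_eq_eigenvalues] using hmem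

theorem dotProduct_self_eq_sum_sq {M : Matrix ι ι ℝ} (hM : M.IsHermitian) (x : ι → ℝ) :
    x ⬝ᵥ x = ∑ j, ((star (hM.eigenvectorUnitary : Matrix ι ι ℝ)) *ᵥ x) j ^ 2 := by
  set U : Matrix ι ι ℝ := hM.eigenvectorUnitary.1 with hU
  have h : U * star U = 1 := Unitary.coe_mul_star_self hM.eigenvectorUnitary
  have hs : star U = Uᵀ := by simp [star_eq_conjTranspose]
  calc x ⬝ᵥ x = x ⬝ᵥ ((U * star U) *ᵥ x) := by rw [h, one_mulVec]
    _ = (star U *ᵥ x) ⬝ᵥ (star U *ᵥ x) := by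
      rw [← mulVec_mulVec, dotProduct_mulVec, hs, mulVec_transpose]
    _ = _ := by simp [dotProduct, sq]

theorem dotProduct_mulVec_eq_sum {M : Matrix ι ι ℝ} (hM : M.IsHermitian) (x : ι → ℝ) :
    x ⬝ᵥ (M *ᵥ x) = ∑ j, hM.eigenvalues j *
      ((star (hM.eigenvectorUnitary : Matrix ι ι ℝ)) *ᵥ x) j ^ 2 := by
  have hsp := hM.spectral_theorem
  rw [Unitary.conjStarAlgAut_apply] at hsp
  set U : Matrix ι ι ℝ := hM.eigenvectorUnitary.1 with hU
  have hs : star U = Uᵀ := by simp [star_eq_conjTranspose]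
  calc x ⬝ᵥ (M *ᵥ x)
      = x ⬝ᵥ ((U * diagonal (RCLike.ofReal ∘ hM.eigenvalues) * star U) *ᵥ x) := by rw [← hsp]
    _ = (star U *ᵥ x) ⬝ᵥ (diagonal hM.eigenvalues *ᵥ (star U *ᵥ x)) := by
      rw [← mulVec_mulVec, ← mulVec_mulVec, dotProduct_mulVec, hs, mulVec_transpose]
      rfl
    _ = _ := by
      simp only [dotProduct, mulVec_diagonal]
      exact Finset.sum_congr rfl fun j _ => by ring

/-- If a linear map does not increase the quadratic form and does not decrease the norm, then the
target matrix has at least as many eigenvalues below a nonnegative threshold as the source. -/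
theorem card_eigenvalues_le_of_linearMap {A : Matrix ι ι ℝ} {B : Matrix κ κ ℝ}
    (hA : A.IsHermitian) (hB : B.IsHermitian) (E : (κ → ℝ) →ₗ[ℝ] (ι → ℝ))
    (hform : ∀ x, E x ⬝ᵥ (A *ᵥ E x) ≤ x ⬝ᵥ (B *ᵥ x))
    (hnorm : ∀ x, x ⬝ᵥ x ≤ E x ⬝ᵥ E x) {c : ℝ} (hc : 0 ≤ c) :
    Fintype.card {j // hB.eigenvalues j ≤ c} ≤ Fintype.card {j // hA.eigenvalues j ≤ c} := by
  set U : Matrix κ κ ℝ := hB.eigenvectorUnitary.1 with hU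
  set W : Matrix ι ι ℝ := hA.eigenvectorUnitary.1 with hW
  have hUU : star U * U = 1 := Unitary.coe_star_mul_self hB.eigenvectorUnitary
  let ext : ({j // hB.eigenvalues j ≤ c} → ℝ) →ₗ[ℝ] (κ → ℝ) :=
    Function.ExtendByZero.linearMap ℝ Subtype.val
  let Φ : ({j // hB.eigenvalues j ≤ c} → ℝ) →ₗ[ℝ] ({j // hA.eigenvalues j ≤ c} → ℝ) :=
    LinearMap.funLeft ℝ ℝ Subtype.val ∘ₗ (star W).mulVecLin ∘ₗ E ∘ₗ U.mulVecLin ∘ₗ ext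
  suffices hinj : Function.Injective Φ by
    simpa using LinearMap.finrank_le_finrank_of_injective hinj
  refine (injective_iff_map_eq_zero Φ).2 fun a ha => ?_
  set x := U *ᵥ ext a with hx
  have hUx : star U *ᵥ x = ext a := by rw [hx, mulVec_mulVec, hUU, one_mulVec]
  have hxx : x ⬝ᵥ x = ∑ j, ext a j ^ 2 := by rw [hB.dotProduct_self_eq_sum_sq, hUx]
  have hext0 : ∀ j, ¬ hB.eigenvalues j ≤ c → ext a j = 0 := fun j hj =>
    Function.extend_apply' _ _ _ (by rintro ⟨⟨k, hk⟩, rfl⟩; exact hj hk)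
  have hxB : x ⬝ᵥ (B *ᵥ x) ≤ c * (x ⬝ᵥ x) := by
    rw [hxx, hB.dotProduct_mulVec_eq_sum, hUx, Finset.mul_sum]
    refine Finset.sum_le_sum fun j _ => ?_
    by_cases hj : hB.eigenvalues j ≤ c
    · exact mul_le_mul_of_nonneg_right hj (sq_nonneg _)
    · simp [hext0 j hj]
  have hz0 : ∀ j, hA.eigenvalues j ≤ c → (star W *ᵥ E x) j = 0 := fun j hj => congrFun ha ⟨j, hj⟩
  have hsum : ∑ j, (hA.eigenvalues j - c) * (star W *ᵥ E x) j ^ 2 ≤ 0 := by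
    have h := (hform x).trans (hxB.trans (mul_le_mul_of_nonneg_left (hnorm x) hc))
    rw [hA.dotProduct_mulVec_eq_sum, hA.dotProduct_self_eq_sum_sq, Finset.mul_sum] at h
    simpa only [sub_mul, Finset.sum_sub_distrib, sub_nonpos] using h
  have hterm : ∀ j, 0 ≤ (hA.eigenvalues j - c) * (star W *ᵥ E x) j ^ 2 := fun j => by
    by_cases hj : hA.eigenvalues j ≤ c
    · simp [hz0 j hj]
    · exact mul_nonneg (sub_nonneg.2 (not_le.1 hj).le) (sq_nonneg _)
  have hz : ∀ j, (star W *ᵥ E x) j = 0 := fun j => by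
    by_cases hj : hA.eigenvalues j ≤ c
    · exact hz0 j hj
    · have h := (Finset.sum_eq_zero_iff_of_nonneg fun j _ => hterm j).1
        (le_antisymm hsum (Finset.sum_nonneg fun j _ => hterm j)) j (Finset.mem_univ j)
      have hne : hA.eigenvalues j - c ≠ 0 := (sub_pos.2 (not_le.1 hj)).ne'
      simpa [hne] using h
  have hEx : E x ⬝ᵥ E x = 0 := by
    rw [hA.dotProduct_self_eq_sum_sq]
    exact Finset.sum_eq_zero fun j _ => by rw [hz j, sq, zero_mul]
  have hzero : ∑ j, ext a j ^ 2 = 0 :=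
    le_antisymm (hxx ▸ hEx ▸ hnorm x) (Finset.sum_nonneg fun j _ => sq_nonneg _)
  funext j
  have h := (Finset.sum_eq_zero_iff_of_nonneg fun j _ => sq_nonneg (ext a j)).1 hzero j
    (Finset.mem_univ _)
  have hj : ext a j = a j := Subtype.val_injective.extend_apply _ _ _
  rw [hj] at h
  simpa using h

end Matrix.IsHermitian

namespace SimpleGraph

variable {V : Type*} {T : SimpleGraph V}

theorem IsAcyclic.eq_of_reachable_deleteEdges (hT : T.IsAcyclic) {H : T.Subgraph}
    (hH : H.coe.Connected) {u v : V} (hu : u ∈ H.verts) (hv : v ∈ H.verts)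
    (h : (T.deleteEdges H.edgeSet).Reachable u v) : u = v := by
  obtain ⟨p, hp⟩ := h.exists_isPath
  obtain ⟨q, hq⟩ := (hH.preconnected ⟨u, hu⟩ ⟨v, hv⟩).exists_isPath
  have hle : T.deleteEdges H.edgeSet ≤ T := deleteEdges_le _
  have heq : p.mapLe hle = q.map H.hom := congrArg Subtype.val <|
    (hT.subsingleton_path u v).elim ⟨_, hp.mapLe hle⟩ ⟨_, hq.map Subtype.val_injective⟩
  cases p with
  | nil => rfl
  | @cons _ w _ huw p =>
    have hmem : s(u, w) ∈ (q.map H.hom).edges := by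
      rw [← heq]
      simp
    rw [Walk.edges_map, List.mem_map] at hmem
    obtain ⟨e, he, hew⟩ := hmem
    have he' := q.edges_subset_edgeSet he
    have : s(u, w) ∈ H.edgeSet := by
      rw [← hew]
      induction e with
      | _ a b => exact he'
    exact absurd this (deleteEdges_adj.1 huw).2

theorem Connected.exists_reachable_deleteEdges (hT : T.Connected) (H : T.Subgraph)
    (hH : H.verts.Nonempty) (x : V) :
    ∃ h : H.verts, (T.deleteEdges H.edgeSet).Reachable x h := by
  obtain ⟨h₀, hh₀⟩ := hH
  obtain ⟨p⟩ := hT.preconnected x h₀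
  induction p with
  | nil => exact ⟨⟨_, hh₀⟩, .refl _⟩
  | @cons a b _ hab p ih =>
    by_cases hadj : H.Adj a b
    · exact ⟨⟨a, H.edge_vert hadj⟩, .refl _⟩
    · obtain ⟨h, hh⟩ := ih hh₀
      have hab' : (T.deleteEdges H.edgeSet).Adj a b := deleteEdges_adj.2 ⟨hab, hadj⟩
      exact ⟨h, hab'.reachable.trans hh⟩

/-- A tree retracts onto each of its subtrees: every edge is either an edge of the subtree or
collapsed to a point. -/
theorem IsTree.exists_retraction (hT : T.IsTree) {H : T.Subgraph} (hH : H.coe.Connected) :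
    ∃ r : V → H.verts, (∀ h : H.verts, r h = h) ∧
      ∀ x y, T.Adj x y → ¬ H.Adj x y → r x = r y := by
  have hne : H.verts.Nonempty := Set.nonempty_coe_sort.1 hH.nonempty
  choose r hr using hT.connected.exists_reachable_deleteEdges H hne
  refine ⟨r, fun h => ?_, fun x y hxy hn => ?_⟩
  · exact Subtype.ext
      (hT.isAcyclic.eq_of_reachable_deleteEdges hH h.2 (r h).2 (hr h)).symm
  · have hxy' : (T.deleteEdges H.edgeSet).Adj x y := deleteEdges_adj.2 ⟨hxy, hn⟩
    exact Subtype.ext (hT.isAcyclic.eq_of_reachable_deleteEdges hH (r x).2 (r y).2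
      ((hr x).symm.trans (hxy'.reachable.trans (hr y))))

variable [Fintype V]

theorem dotProduct_self_le_comp_retraction {s : Set V} {r : V → s} (hr : ∀ h : s, r h = h)
    (f : s → ℝ) : f ⬝ᵥ f ≤ (f ∘ r) ⬝ᵥ (f ∘ r) := by
  simp only [dotProduct, Function.comp_apply]
  calc ∑ h, f h * f h = ∑ h : s, f (r h) * f (r h) := by simp only [hr]
    _ = ∑ x ∈ s.toFinset, f (r x) * f (r x) :=
      (Finset.sum_subtype _ (fun x => Set.mem_toFinset) fun x => f (r x) * f (r x)).symm
    _ ≤ _ := Finset.sum_le_univ_sum_of_nonneg fun x => mul_self_nonneg _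

theorem lapMatrix_form_comp_retraction [DecidableEq V] [DecidableRel T.Adj] {H : T.Subgraph}
    {_ : DecidableEq H.verts} {_ : DecidableRel H.coe.Adj} {r : V → H.verts}
    (hr : ∀ h : H.verts, r h = h) (hadj : ∀ x y, T.Adj x y → ¬ H.Adj x y → r x = r y)
    (f : H.verts → ℝ) :
    (f ∘ r) ⬝ᵥ (T.lapMatrix ℝ *ᵥ (f ∘ r)) = f ⬝ᵥ (H.coe.lapMatrix ℝ *ᵥ f) := by
  rw [← toLinearMap₂'_apply', ← toLinearMap₂'_apply', lapMatrix_toLinearMap₂',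
    lapMatrix_toLinearMap₂']
  congr 1
  set F : V → V → ℝ := fun x y => if H.Adj x y then (f (r x) - f (r y)) ^ 2 else 0 with hF
  have hsub : ∀ g : V → ℝ, (∀ x, x ∉ H.verts → g x = 0) → ∑ x, g x = ∑ h : H.verts, g h := by
    intro g hg
    rw [← Finset.sum_subtype H.verts.toFinset (fun x => Set.mem_toFinset) g]
    exact (Finset.sum_subset (Finset.subset_univ _) fun x _ hx =>
      hg x (by simpa using hx)).symm
  calc (∑ x, ∑ y, if T.Adj x y then ((f ∘ r) x - (f ∘ r) y) ^ 2 else 0)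
      = ∑ x, ∑ y, F x y := by
        refine Finset.sum_congr rfl fun x _ => Finset.sum_congr rfl fun y _ => ?_
        by_cases hH : H.Adj x y
        · simp [hF, hH, hH.adj_sub]
        · by_cases hT : T.Adj x y
          · simp [hF, hH, hadj x y hT hH]
          · simp [hF, hH, hT]
    _ = ∑ a : H.verts, ∑ b : H.verts, F a b := by
        rw [hsub _ fun x hx => Finset.sum_eq_zero fun y _ =>
          if_neg fun h => hx (H.edge_vert h)]
        exact Finset.sum_congr rfl fun a _ => hsub _ fun y hy =>
          if_neg fun h => hy (H.edge_vert h.symm)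
    _ = _ := by
        refine Finset.sum_congr rfl fun a _ => Finset.sum_congr rfl fun b _ => ?_
        simp [hF, hr]

theorem lapEig_le_of_linearMap {W : Type*} [Fintype W] {G : SimpleGraph V} {K : SimpleGraph W}
    {i : ℕ} (hi1 : 1 ≤ i) (hi2 : i ≤ Fintype.card W) (hcard : Fintype.card W ≤ Fintype.card V)
    (E : (W → ℝ) →ₗ[ℝ] (V → ℝ))
    (hform : ∀ f, E f ⬝ᵥ (G.lapMatrix ℝ *ᵥ E f) ≤ f ⬝ᵥ (K.lapMatrix ℝ *ᵥ f))
    (hnorm : ∀ f, f ⬝ᵥ f ≤ E f ⬝ᵥ E f) : lapEig G i ≤ lapEig K i := by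
  have hA := G.isHermitian_lapMatrix ℝ
  have hB := K.isHermitian_lapMatrix ℝ
  have hc : 0 ≤ lapEig K i := by
    obtain ⟨j, hj⟩ := hB.exists_eigenvalues_eq_kthEig hi1 hi2
    rw [lapEig, ← hj]
    exact (K.posSemidef_lapMatrix ℝ).eigenvalues_nonneg j
  exact (hA.kthEig_le_iff hi1 (hi2.trans hcard) _).2 <|
    ((hB.kthEig_le_iff hi1 hi2 _).1 le_rfl).trans <|
    hA.card_eigenvalues_le_of_linearMap hB E hform hnorm hc

end SimpleGraph

/-- **Lemma (monotonicity of Laplacian eigenvalues under subtrees).**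
If `T'` is a subtree (connected subgraph) of a finite tree `T` with `n'` vertices, then
`λ_i(T) ≤ λ_i(T')` for all `i = 1, …, n'`. -/
theorem lapEig_le_of_subtree
    {V : Type*} [Fintype V] (T : SimpleGraph V) (hT : T.IsTree)
    (H : T.Subgraph) (hH : H.coe.Connected)
    (i : ℕ) (hi1 : 1 ≤ i) (hi2 : i ≤ Fintype.card H.verts) :
    lapEig T i ≤ lapEig H.coe i := by
  obtain ⟨r, hr, hadj⟩ := hT.exists_retraction hH
  exact SimpleGraph.lapEig_le_of_linearMap hi1 hi2
    (Fintype.card_le_of_injective _ Subtype.val_injective) (LinearMap.funLeft ℝ ℝ r)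
    (fun f => (SimpleGraph.lapMatrix_form_comp_retraction hr hadj f).le)
    (SimpleGraph.dotProduct_self_le_comp_retraction hr)

end
end

section
/- Let b ≥ 2 and r ≥ 1 be integers. Then the algebraic connectivity of the spider graph Sp_{b;r} equals λ2(P_{2r+1}) = 4 sin²(π/(4r+2)). -/
open scoped Classical

noncomputable section

/-- Vertices of the one-length spider graph. -/
abbrev Spider1V (b r : ℕ) := Option (Fin b × Fin r)

def spider1Rel (b r : ℕ) : Spider1V b r → Spider1V b r → Prop
  | none, some (_, j) => j.val = 0
  | some (i, j), some (i', j') => i = i' ∧ j'.val = j.val + 1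
  | _, _ => False

/-- The spider graph `Sp_{b;r}`: `b` paths of length `r` with one endpoint of each path
identified to a common center. -/
def spider1 (b r : ℕ) : SimpleGraph (Spider1V b r) :=
  SimpleGraph.fromRel (spider1Rel b r)

open Matrix

/-- A symmetric real matrix that annihilates constants, has an eigenvector for `μ > 0`, and whose
quadratic form is at least `μ` on the vectors with zero sum, has second eigenvalue `μ`. -/
theorem kthEig_two_eq {ι : Type*} [Fintype ι] [DecidableEq ι] [Nonempty ι] {M : Matrix ι ι ℝ}
    (hM : M.IsHermitian) {μ : ℝ} (hμ : 0 < μ) (hone : M *ᵥ (fun _ => 1) = 0)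
    (hform : ∀ x : ι → ℝ, ∑ v, x v = 0 → μ * (x ⬝ᵥ x) ≤ x ⬝ᵥ (M *ᵥ x))
    {u : ι → ℝ} (hu : u ≠ 0) (hMu : M *ᵥ u = μ • u) : kthEig M 2 = μ := by
  have hspec : ∀ (t : ℝ) (x : ι → ℝ), x ≠ 0 → M *ᵥ x = t • x →
      ∃ i, hM.eigenvalues i = t := by
    intro t x hx hMx
    have h : t ∈ spectrum ℝ M := by
      rw [← Matrix.spectrum_toLin']
      refine (Module.End.hasEigenvalue_of_hasEigenvector (x := x) ?_).mem_spectrum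
      exact ⟨Module.End.mem_eigenspace_iff.2 (by simpa using hMx), hx⟩
    rw [hM.spectrum_real_eq_range_eigenvalues] at h
    exact h
  obtain ⟨i₀, hi₀⟩ := hspec 0 (fun _ => 1)
    (fun h => one_ne_zero (congrFun h (Classical.arbitrary ι))) (by simpa using hone)
  obtain ⟨i₁, hi₁⟩ := hspec μ u hu hMu
  have hne : i₁ ≠ i₀ := by
    rintro rfl
    exact hμ.ne' (hi₁.symm.trans hi₀)
  have hmem : ∀ i, i ≠ i₀ → μ ≤ hM.eigenvalues i := by
    intro i hi
    by_contra! hlt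
    set v : ι → ι → ℝ := fun j => ⇑(hM.eigenvectorBasis j) with hv
    have horth : ∀ j k, v j ⬝ᵥ v k = if j = k then 1 else 0 := by
      intro j k
      have h := orthonormal_iff_ite.1 hM.eigenvectorBasis.orthonormal j k
      rw [← h, EuclideanSpace.inner_eq_star_dotProduct, dotProduct_comm]
      simp [hv]
    have hMv : ∀ j, M *ᵥ v j = hM.eigenvalues j • v j := hM.mulVec_eigenvectorBasis
    obtain ⟨α, β, hαβ, hsum⟩ : ∃ α β : ℝ, 0 < α ^ 2 + β ^ 2 ∧
        α * ∑ w, v i w + β * ∑ w, v i₀ w = 0 := by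
      by_cases h : ∑ w, v i w = 0
      · exact ⟨1, 0, by norm_num, by simp [h]⟩
      · exact ⟨∑ w, v i₀ w, -∑ w, v i w, add_pos_of_nonneg_of_pos (sq_nonneg _)
          (sq_pos_of_ne_zero (neg_ne_zero.2 h)), by ring⟩
    have h := hform (α • v i + β • v i₀) (by
      simpa [Finset.sum_add_distrib, ← Finset.mul_sum] using hsum)
    simp only [mulVec_add, mulVec_smul, hMv, hi₀, add_dotProduct, dotProduct_add, smul_dotProduct,
      dotProduct_smul, horth, if_neg hi, if_neg hi.symm, if_true, smul_eq_mul] at h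
    have hmin : 0 < min (μ - hM.eigenvalues i) μ := lt_min (sub_pos.2 hlt) hμ
    have hα := mul_le_mul_of_nonneg_right (min_le_left (μ - hM.eigenvalues i) μ) (sq_nonneg α)
    have hβ := mul_le_mul_of_nonneg_right (min_le_right (μ - hM.eigenvalues i) μ) (sq_nonneg β)
    linarith [mul_pos hmin hαβ]
  obtain ⟨s, hs⟩ := Multiset.exists_cons_of_mem (Finset.mem_univ_val i₀)
  have hnodup : (i₀ ::ₘ s).Nodup := hs ▸ Finset.univ.nodup
  have hi₁s : i₁ ∈ s := by
    have h : i₁ ∈ i₀ ::ₘ s := hs ▸ Finset.mem_univ_val i₁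
    exact (Multiset.mem_cons.1 h).resolve_left hne
  have hge : ∀ i ∈ s, μ ≤ hM.eigenvalues i := fun i his => hmem i fun h =>
    (Multiset.nodup_cons.1 hnodup).1 (h ▸ his)
  obtain ⟨t, rfl⟩ := Multiset.exists_cons_of_mem hi₁s
  have hroots : M.charpoly.roots = 0 ::ₘ μ ::ₘ t.map hM.eigenvalues := by
    rw [hM.roots_charpoly_eq_eigenvalues, hs]
    simp [hi₀, hi₁]
  have hμt : ∀ a ∈ t.map hM.eigenvalues, μ ≤ a := by
    intro a ha
    obtain ⟨i, hi, rfl⟩ := Multiset.mem_map.1 ha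
    exact hge i (Multiset.mem_cons_of_mem hi)
  rw [kthEig, hroots, Multiset.sort_cons, Multiset.sort_cons _ _ _ hμt]
  · rfl
  · intro a ha
    rcases Multiset.mem_cons.1 ha with rfl | ha
    · exact hμ.le
    · exact hμ.le.trans (hμt a ha)

theorem lapEig_two_eq {V : Type*} [Fintype V] [Nonempty V] {G : SimpleGraph V}
    {B : (V → ℝ) → (V → ℝ) → ℝ} (hB : ∀ h x, h ⬝ᵥ (SimpleGraph.lapMatrix ℝ G *ᵥ x) = B h x)
    {μ : ℝ} (hμ : 0 < μ) (hform : ∀ x : V → ℝ, ∑ v, x v = 0 → μ * (x ⬝ᵥ x) ≤ B x x)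
    {u : V → ℝ} (hu : u ≠ 0) (hBu : ∀ h, B h u = μ * (h ⬝ᵥ u)) : lapEig G 2 = μ := by
  refine kthEig_two_eq (SimpleGraph.isHermitian_lapMatrix ℝ G) hμ
    (SimpleGraph.lapMatrix_mulVec_const_eq_zero G) (fun x hx => ?_) hu
    (dotProduct_eq _ _ fun h => ?_)
  · rw [hB]
    exact hform x hx
  · rw [dotProduct_comm, dotProduct_comm _ h, hB, hBu, dotProduct_smul, smul_eq_mul]

theorem lapEig_congr {V W : Type*} [Fintype V] [Fintype W] {G : SimpleGraph V}
    {H : SimpleGraph W} (e : G ≃g H) (k : ℕ) : lapEig G k = lapEig H k := by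
  have h : SimpleGraph.lapMatrix ℝ H =
      Matrix.reindex e.toEquiv e.toEquiv (SimpleGraph.lapMatrix ℝ G) := by
    ext v w
    obtain ⟨v, rfl⟩ := e.surjective v
    obtain ⟨w, rfl⟩ := e.surjective w
    have hdeg : H.degree (e v) = G.degree v := by
      convert e.degree_eq v
    have hsymm : ∀ x, e.toEquiv.symm (e x) = x := e.toEquiv.symm_apply_apply
    simp [SimpleGraph.lapMatrix, SimpleGraph.degMatrix, Matrix.diagonal_apply,
      SimpleGraph.adjMatrix_apply, e.map_adj_iff, hdeg, hsymm]
  rw [lapEig, lapEig, h, kthEig, kthEig, Matrix.charpoly_reindex]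

theorem dotProduct_lapMatrix_mulVec {V : Type*} [Fintype V] [DecidableEq V] (G : SimpleGraph V)
    [DecidableRel G.Adj] (h x : V → ℝ) :
    h ⬝ᵥ (SimpleGraph.lapMatrix ℝ G *ᵥ x) =
      ∑ v, ∑ w, if G.Adj v w then h v * (x v - x w) else 0 := by
  refine Finset.sum_congr rfl fun v _ => ?_
  rw [SimpleGraph.lapMatrix_mulVec_apply, ← Finset.sum_filter, ← Finset.mul_sum,
    ← SimpleGraph.neighborFinset_eq_filter, Finset.sum_sub_distrib]
  simp

theorem dotProduct_lapMatrix_mulVec_of_orientation {V : Type*} [Fintype V] [DecidableEq V]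
    {G : SimpleGraph V} [DecidableRel G.Adj] {R : V → V → Prop} [DecidableRel R]
    (hG : ∀ v w, G.Adj v w ↔ R v w ∨ R w v) (hR : ∀ v w, R v w → ¬ R w v) (h x : V → ℝ) :
    h ⬝ᵥ (SimpleGraph.lapMatrix ℝ G *ᵥ x) =
      ∑ v, ∑ w, if R v w then (h w - h v) * (x w - x v) else 0 := by
  have hsplit : ∀ v w, (if G.Adj v w then h v * (x v - x w) else 0) =
      (if R v w then h v * (x v - x w) else 0) + if R w v then h v * (x v - x w) else 0 := by
    intro v w
    by_cases hvw : R v w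
    · simp [hG, hvw, hR v w hvw]
    · simp [hG, hvw]
  rw [dotProduct_lapMatrix_mulVec]
  simp_rw [hsplit, Finset.sum_add_distrib]
  rw [Finset.sum_comm (f := fun v w => if R w v then h v * (x v - x w) else 0)]
  simp_rw [← Finset.sum_add_distrib]
  refine Finset.sum_congr rfl fun v _ => Finset.sum_congr rfl fun w _ => ?_
  split_ifs <;> ring

/-- The vertex at distance `j ≤ r` from the center on the `i`-th leg of the spider. -/
def spiderLeg {b r : ℕ} (i : Fin b) : ℕ → Spider1V b r
  | 0 => none
  | j + 1 => if h : j < r then some (i, ⟨j, h⟩) else none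

theorem spiderLeg_succ {b r : ℕ} (i : Fin b) (j : Fin r) :
    spiderLeg i (j.val + 1) = some (i, j) := by
  simp [spiderLeg]

theorem spider1Rel_some {b r : ℕ} (v : Spider1V b r) (i : Fin b) (j : Fin r) :
    spider1Rel b r v (some (i, j)) ↔ v = spiderLeg i j.val := by
  obtain ⟨j, hj⟩ := j
  rcases v with _ | ⟨i', j', hj'⟩ <;> cases j with
  | zero => simp [spider1Rel, spiderLeg]
  | succ j =>
    have hj : j < r := by omega
    simp [spider1Rel, spiderLeg, hj, eq_comm]

theorem not_spider1Rel_none {b r : ℕ} (v : Spider1V b r) : ¬ spider1Rel b r v none := by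
  rcases v with _ | ⟨i, j⟩ <;> simp [spider1Rel]

theorem spider1Rel_asymm {b r : ℕ} (v w : Spider1V b r) (h : spider1Rel b r v w) :
    ¬ spider1Rel b r w v := by
  rcases v with _ | ⟨i, j⟩ <;> rcases w with _ | ⟨i', j'⟩ <;> simp_all [spider1Rel]
  omega

theorem sum_spider1V {b r : ℕ} (f : Spider1V b r → ℝ) :
    ∑ v, f v = f none + ∑ i : Fin b, ∑ j ∈ Finset.range r, f (spiderLeg i (j + 1)) := by
  simp_rw [Fintype.sum_option, Fintype.sum_prod_type, Finset.sum_range, spiderLeg_succ]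

theorem dotProduct_lapMatrix_spider1_mulVec {b r : ℕ} (h x : Spider1V b r → ℝ) :
    h ⬝ᵥ (SimpleGraph.lapMatrix ℝ (spider1 b r) *ᵥ x) =
      ∑ i : Fin b, ∑ j ∈ Finset.range r,
        (h (spiderLeg i (j + 1)) - h (spiderLeg i j)) *
          (x (spiderLeg i (j + 1)) - x (spiderLeg i j)) := by
  have hadj : ∀ v w, (spider1 b r).Adj v w ↔ spider1Rel b r v w ∨ spider1Rel b r w v := by
    intro v w
    rw [spider1, SimpleGraph.fromRel_adj, and_iff_right_iff_imp]
    rintro h rfl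
    exact h.elim (fun h => spider1Rel_asymm v v h h) fun h => spider1Rel_asymm v v h h
  rw [dotProduct_lapMatrix_mulVec_of_orientation hadj spider1Rel_asymm, Finset.sum_comm,
    Fintype.sum_option]
  simp only [not_spider1Rel_none, if_false, Finset.sum_const_zero, zero_add, spider1Rel_some,
    Finset.sum_ite_eq', Finset.mem_univ, if_true, Fintype.sum_prod_type, Finset.sum_range,
    spiderLeg_succ]

/-- Discrete Picone inequality: a positive solution `p` of `-Δp = μp` with `p 0 = 0` bounds the
Dirichlet energy of every `g` with `g 0 = 0` from below. -/
theorem picone_sum_range {p g : ℕ → ℝ} {μ : ℝ} (hp0 : p 0 = 0) (hg0 : g 0 = 0) (k : ℕ)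
    (hpos : ∀ j, j ≤ k → 0 < p (j + 1))
    (hrec : ∀ j, p (j + 2) = (2 - μ) * p (j + 1) - p j) :
    μ * ∑ j ∈ Finset.range (k + 1), g (j + 1) ^ 2 + g (k + 1) ^ 2 * (p (k + 2) / p (k + 1) - 1) ≤
      ∑ j ∈ Finset.range (k + 1), (g (j + 1) - g j) ^ 2 := by
  induction k with
  | zero =>
    have h1 := hpos 0 le_rfl
    have h2 : p 2 / p 1 = 2 - μ := by
      rw [hrec 0, hp0]
      field_simp
      ring
    simp [h2, hg0]
    linarith
  | succ k ih =>
    have ih := ih fun j hj => hpos j (by omega)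
    have h1 := hpos k (by omega)
    have h2 : 0 < p (k + 2) := hpos (k + 1) le_rfl
    rw [Finset.sum_range_succ _ (k + 1), Finset.sum_range_succ _ (k + 1)]
    have h3 : p (k + 1 + 2) / p (k + 1 + 1) = 2 - μ - p (k + 1) / p (k + 2) := by
      rw [hrec (k + 1)]
      change ((2 - μ) * p (k + 2) - p (k + 1)) / p (k + 2) = _
      field_simp
    have h4 : 0 ≤ g (k + 1) ^ 2 * (p (k + 2) / p (k + 1)) - 2 * g (k + 2) * g (k + 1) +
        g (k + 2) ^ 2 * (p (k + 1) / p (k + 2)) := by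
      have : g (k + 1) ^ 2 * (p (k + 2) / p (k + 1)) - 2 * g (k + 2) * g (k + 1) +
          g (k + 2) ^ 2 * (p (k + 1) / p (k + 2)) =
          (p (k + 2) * g (k + 1) - p (k + 1) * g (k + 2)) ^ 2 / (p (k + 1) * p (k + 2)) := by
        field_simp
        ring
      rw [this]
      positivity
    rw [h3]
    change _ * (_ + g (k + 2) ^ 2) + g (k + 2) ^ 2 * _ ≤ _ + (g (k + 2) - g (k + 1)) ^ 2
    linarith

theorem sum_range_sub_mul_sub_of_rec {p : ℕ → ℝ} {μ : ℝ} (g : ℕ → ℝ) (k : ℕ)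
    (hrec : ∀ j, p (j + 2) = (2 - μ) * p (j + 1) - p j) :
    ∑ j ∈ Finset.range k, (g (j + 1) - g j) * (p (j + 1) - p j) =
      μ * ∑ j ∈ Finset.range k, g (j + 1) * p (j + 1) + g k * (p (k + 1) - p k) -
        g 0 * (p 1 - p 0) := by
  induction k with
  | zero => simp
  | succ k ih =>
    rw [Finset.sum_range_succ, Finset.sum_range_succ, ih, hrec k]
    ring

theorem sin_succ_succ_mul (θ : ℝ) (j : ℕ) :
    Real.sin ((j + 2 : ℕ) * θ) =
      (2 - 4 * Real.sin (θ / 2) ^ 2) * Real.sin ((j + 1 : ℕ) * θ) - Real.sin (j * θ) := by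
  have h1 : Real.sin ((j + 2 : ℕ) * θ) = Real.sin ((j + 1 : ℕ) * θ + θ) := by
    push_cast
    ring_nf
  have h2 : Real.sin (j * θ) = Real.sin ((j + 1 : ℕ) * θ - θ) := by
    push_cast
    ring_nf
  have h3 : 2 - 4 * Real.sin (θ / 2) ^ 2 = 2 * Real.cos θ := by
    have h := Real.cos_two_mul' (θ / 2)
    rw [mul_div_cancel₀ θ two_ne_zero] at h
    nlinarith [Real.sin_sq_add_cos_sq (θ / 2)]
  rw [h1, h2, h3, Real.sin_add, Real.sin_sub]
  ring

theorem lapEig_spider1_two (b r : ℕ) (hb : 2 ≤ b) (hr : 1 ≤ r) :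
    lapEig (spider1 b r) 2 = 4 * Real.sin (Real.pi / (4 * (r : ℝ) + 2)) ^ 2 := by
  set θ : ℝ := Real.pi / (2 * r + 1) with hθ
  have hr0 : (0 : ℝ) < 2 * r + 1 := by positivity
  have hθpos : 0 < θ := by positivity
  have hθr : θ * (2 * r + 1) = Real.pi := div_mul_cancel₀ _ hr0.ne'
  have hhalf : Real.pi / (4 * (r : ℝ) + 2) = θ / 2 := by
    rw [hθ]
    field_simp
    ring
  rw [hhalf]
  set μ : ℝ := 4 * Real.sin (θ / 2) ^ 2 with hμdef
  set p : ℕ → ℝ := fun j => Real.sin (j * θ) with hp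
  have hrec : ∀ j, p (j + 2) = (2 - μ) * p (j + 1) - p j := sin_succ_succ_mul θ
  have hp0 : p 0 = 0 := by simp [hp]
  have hppos : ∀ j, j < r → 0 < p (j + 1) := by
    intro j hj
    have hj' : (j : ℝ) + 1 ≤ r := by exact_mod_cast hj
    apply Real.sin_pos_of_pos_of_lt_pi
    · positivity
    · push_cast
      nlinarith
  have hpr : p (r + 1) = p r := by
    simp only [hp]
    rw [← Real.sin_pi_sub (r * θ), ← hθr]
    push_cast
    ring_nf
  have hμpos : 0 < μ := by
    have : 0 < Real.sin (θ / 2) := by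
      apply Real.sin_pos_of_pos_of_lt_pi
      · positivity
      · nlinarith [Nat.cast_nonneg (α := ℝ) r]
    positivity
  have hdirichlet : ∀ g : ℕ → ℝ, g 0 = 0 →
      μ * ∑ j ∈ Finset.range r, g (j + 1) ^ 2 ≤ ∑ j ∈ Finset.range r, (g (j + 1) - g j) ^ 2 := by
    intro g hg
    obtain ⟨k, rfl⟩ : ∃ k, r = k + 1 := ⟨r - 1, by omega⟩
    have h := picone_sum_range hp0 hg k (fun j hj => hppos j (by omega)) hrec
    have h1 := hppos k (by omega)
    rwa [show p (k + 2) = p (k + 1) from hpr, div_self h1.ne', sub_self, mul_zero, add_zero] at h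
  set c : Fin b → ℝ := Pi.single ⟨0, by omega⟩ 1 - Pi.single ⟨1, by omega⟩ 1 with hc
  have hcsum : ∑ i, c i = 0 := by simp [hc]
  set u : Spider1V b r → ℝ := fun v => v.elim 0 fun q => c q.1 * p (q.2.val + 1) with hu
  have huleg : ∀ i j, j ≤ r → u (spiderLeg i j) = c i * p j := by
    intro i j hj
    cases j with
    | zero => simp [hu, spiderLeg, hp0]
    | succ j =>
      have hj : j < r := by omega
      simp [hu, spiderLeg, hj]
  refine lapEig_two_eq (u := u) (B := fun h x => ∑ i : Fin b, ∑ j ∈ Finset.range r,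
      (h (spiderLeg i (j + 1)) - h (spiderLeg i j)) *
        (x (spiderLeg i (j + 1)) - x (spiderLeg i j)))
    (fun h x => by convert dotProduct_lapMatrix_spider1_mulVec h x) hμpos ?_ ?_ ?_
  · intro x hx
    have hshift : x ⬝ᵥ x ≤ (fun v => x v - x none) ⬝ᵥ (fun v => x v - x none) := by
      have : (fun v => x v - x none) ⬝ᵥ (fun v => x v - x none) =
          x ⬝ᵥ x + ∑ _v : Spider1V b r, x none ^ 2 - 2 * x none * ∑ v, x v := by
        simp only [dotProduct, Finset.mul_sum, ← Finset.sum_add_distrib, ← Finset.sum_sub_distrib]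
        exact Finset.sum_congr rfl fun v _ => by ring
      rw [this, hx]
      have : 0 ≤ ∑ _v : Spider1V b r, x none ^ 2 := Finset.sum_nonneg fun _ _ => sq_nonneg _
      linarith
    refine (mul_le_mul_of_nonneg_left hshift hμpos.le).trans ?_
    rw [dotProduct, sum_spider1V, sub_self, mul_zero, zero_add,
      Finset.mul_sum]
    refine Finset.sum_le_sum fun i _ => ?_
    have h := hdirichlet (fun j => x (spiderLeg i j) - x none) (by simp [spiderLeg])
    simpa only [sub_sub_sub_cancel_right, pow_two] using h
  · intro h0
    have h := huleg ⟨0, by omega⟩ 1 hr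
    have h1 := hppos 0 hr
    rw [h0] at h
    simp [hc] at h
    exact h1.ne h
  · intro h
    rw [dotProduct, sum_spider1V, show u none = 0 from rfl, mul_zero, zero_add, Finset.mul_sum]
    have hleg : ∀ i : Fin b, ∑ j ∈ Finset.range r,
        (h (spiderLeg i (j + 1)) - h (spiderLeg i j)) *
          (u (spiderLeg i (j + 1)) - u (spiderLeg i j)) =
        μ * ∑ j ∈ Finset.range r, h (spiderLeg i (j + 1)) * u (spiderLeg i (j + 1)) -
          c i * (h none * p 1) := by
      intro i
      have hs := sum_range_sub_mul_sub_of_rec (fun j => h (spiderLeg i j)) r hrec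
      rw [hpr, hp0, sub_self, mul_zero, add_zero, sub_zero] at hs
      calc
        _ = c i * ∑ j ∈ Finset.range r,
              (h (spiderLeg i (j + 1)) - h (spiderLeg i j)) * (p (j + 1) - p j) := by
          rw [Finset.mul_sum]
          refine Finset.sum_congr rfl fun j hj => ?_
          rw [Finset.mem_range] at hj
          rw [huleg i (j + 1) hj, huleg i j hj.le]
          ring
        _ = _ := by
          rw [hs, mul_sub, mul_left_comm, Finset.mul_sum (a := c i)]
          congr 2
          refine Finset.sum_congr rfl fun j hj => ?_
          rw [Finset.mem_range] at hj
          rw [huleg i (j + 1) hj]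
          ring
    simp_rw [hleg, Finset.sum_sub_distrib, ← Finset.sum_mul, hcsum, zero_mul, sub_zero]

/-- The map that lays out the two legs of `Sp_{2;r}` on both sides of the middle of a path. -/
def spiderToPath (r : ℕ) : Spider1V 2 r → Fin (2 * r + 1)
  | none => ⟨r, by omega⟩
  | some (i, j) => if i = 0 then ⟨r + 1 + j, by omega⟩ else ⟨r - 1 - j, by omega⟩

theorem spiderToPath_bijective (r : ℕ) : Function.Bijective (spiderToPath r) := by
  refine (Fintype.bijective_iff_injective_and_card _).2 ⟨?_, by simp⟩
  rintro (_ | ⟨i, j, hj⟩) (_ | ⟨i', j', hj'⟩) h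
  · rfl
  · fin_cases i' <;> simp [spiderToPath] at h <;> omega
  · fin_cases i <;> simp [spiderToPath] at h <;> omega
  · fin_cases i <;> fin_cases i' <;> simp [spiderToPath] at h ⊢ <;> omega

/-- The spider with two legs of length `r` is the path on `2 * r + 1` vertices. -/
def spiderIsoPath (r : ℕ) : spider1 2 r ≃g SimpleGraph.pathGraph (2 * r + 1) where
  toEquiv := Equiv.ofBijective _ (spiderToPath_bijective r)
  map_rel_iff' := by
    rintro (_ | ⟨i, j, hj⟩) (_ | ⟨i', j', hj'⟩) <;>
      rw [SimpleGraph.pathGraph_adj, spider1, SimpleGraph.fromRel_adj]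
    · simp [spider1Rel]
    · fin_cases i' <;> simp [spiderToPath, spider1Rel] <;> omega
    · fin_cases i <;> simp [spiderToPath, spider1Rel] <;> omega
    · fin_cases i <;> fin_cases i' <;> simp [spiderToPath, spider1Rel] <;> omega

/-- **Lemma.** For `b ≥ 2`, `r ≥ 1`, the algebraic connectivity of the spider `Sp_{b;r}`
equals `λ₂(P_{2r+1}) = 4 sin²(π/(4r+2))`. -/
theorem algebraic_connectivity_spider
    (b r : ℕ) (hb : 2 ≤ b) (hr : 1 ≤ r) :
    lapEig (spider1 b r) 2 = lapEig (SimpleGraph.pathGraph (2 * r + 1)) 2 ∧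
    lapEig (spider1 b r) 2 = 4 * Real.sin (Real.pi / (4 * (r : ℝ) + 2)) ^ 2 := by
  refine ⟨?_, lapEig_spider1_two b r hb hr⟩
  rw [lapEig_spider1_two b r hb hr, ← lapEig_congr (spiderIsoPath r),
    lapEig_spider1_two 2 r le_rfl hr]

end
end

section
/- Let b1, b2, r ≥ 1 be integers and let λ = λ_{2i}(P_{2r+1}) be the (2i)-th Laplacian eigenvalue of the path P_{2r+1}, for some i with 1 ≤ i ≤ r. Then λ is a Laplacian eigenvalue of the crab graph CG_{b1,b2;r} whose eigenspace contains a subspace of dimension b1 + b2 − 2 consisting of functions summing to zero on each part of the natural equitable partition of CG_{b1,b2;r} (the parts being the two centers and, for each distance 1 ≤ j ≤ r, the sets of vertices at distance j from each center along the legs). -/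
open scoped Classical

noncomputable section

lemma lapMatrix_mulVec_eq_sum_ite {V : Type*} [Fintype V] [DecidableEq V] (G : SimpleGraph V)
    [DecidableRel G.Adj] (f : V → ℝ) (x : V) :
    (G.lapMatrix ℝ).mulVec f x = ∑ y, if G.Adj x y then f x - f y else 0 := by
  rw [SimpleGraph.lapMatrix_mulVec_apply, ← Finset.sum_filter, Finset.sum_sub_distrib,
    ← SimpleGraph.neighborFinset_eq_filter]
  simp

lemma Fin.sum_ite_val_eq {n : ℕ} (m : ℕ) (g : ℕ → ℝ) :
    (∑ y : Fin n, if y.val = m then g y.val else 0) = if m < n then g m else 0 := by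
  split_ifs with h
  · rw [Finset.sum_eq_single ⟨m, h⟩] <;> simp +contextual [Fin.ext_iff]
  · refine Finset.sum_eq_zero fun y _ => if_neg ?_
    have := y.isLt
    omega

lemma Fin.sum_ite_succ_or_pred {n : ℕ} (m : ℕ) (hm : m < n) (g : ℕ → ℝ) :
    (∑ y : Fin n, if m + 1 = y.val ∨ y.val + 1 = m then g y.val else 0) =
      (if m + 1 < n then g (m + 1) else 0) + if 0 < m then g (m - 1) else 0 := by
  have h : ∀ y : Fin n, (if m + 1 = y.val ∨ y.val + 1 = m then g y.val else 0) =
      (if y.val = m + 1 then g y.val else 0) +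
        if y.val = m - 1 then (if 0 < m then g y.val else 0) else 0 := by
    intro y
    split_ifs <;> first | omega | simp
  rw [Finset.sum_congr rfl fun y _ => h y, Finset.sum_add_distrib, Fin.sum_ite_val_eq,
    Fin.sum_ite_val_eq (m - 1) fun k => if 0 < m then g k else 0, if_pos (by omega : m - 1 < n)]

lemma isRoot_charpoly_of_mulVec_eq {ι : Type*} [Fintype ι] {_ : DecidableEq ι} {M : Matrix ι ι ℝ}
    {v : ι → ℝ} {μ : ℝ} (hv : v ≠ 0) (h : M.mulVec v = μ • v) : M.charpoly.IsRoot μ := by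
  rw [Polynomial.IsRoot, Matrix.eval_charpoly, ← Matrix.exists_mulVec_eq_zero_iff]
  refine ⟨v, hv, ?_⟩
  rw [Matrix.sub_mulVec, h, Matrix.scalar_apply, ← Matrix.smul_one_eq_diagonal,
    Matrix.smul_mulVec, Matrix.one_mulVec, sub_self]

lemma kthEig_eq_of_strictMono {ι : Type*} [Fintype ι] {_ : DecidableEq ι} {n : ℕ}
    (hn : Fintype.card ι = n) {M : Matrix ι ι ℝ} {e : Fin n → ℝ} (he : StrictMono e)
    (h : ∀ k, M.charpoly.IsRoot (e k)) (k : Fin n) :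
    kthEig M (k + 1) = e k := by
  have hle : ((List.ofFn e : List ℝ) : Multiset ℝ) ≤ M.charpoly.roots := by
    rw [Multiset.le_iff_subset (by simpa using List.nodup_ofFn.2 he.injective)]
    intro x hx
    obtain ⟨k, rfl⟩ : ∃ k, e k = x := by simpa [List.mem_ofFn] using hx
    exact (Polynomial.mem_roots M.charpoly_monic.ne_zero).2 (h k)
  have heq : ((List.ofFn e : List ℝ) : Multiset ℝ) = M.charpoly.roots := by
    refine Multiset.eq_of_le_of_card_le hle ((Polynomial.card_roots' _).trans ?_)
    simp [Matrix.charpoly_natDegree_eq_dim, hn]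
  have hsort : M.charpoly.roots.sort (· ≤ ·) = List.ofFn e := by
    refine List.Perm.eq_of_pairwise' (r := (· ≤ ·)) (Multiset.pairwise_sort _ _) ?_ ?_
    · exact List.pairwise_ofFn.2 fun i j hij => (he hij).le
    · rw [← Multiset.coe_eq_coe, Multiset.sort_eq, heq]
  simp [kthEig, hsort]

lemma pathGraph_lapMatrix_mulVec_cos (n : ℕ) {_ : DecidableEq (Fin n)}
    {_ : DecidableRel (SimpleGraph.pathGraph n).Adj} (θ : ℝ) (hθ : Real.sin (n * θ) = 0) :
    ((SimpleGraph.pathGraph n).lapMatrix ℝ).mulVec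
        (fun x : Fin n => Real.cos ((x.val + 1 / 2) * θ)) =
      (2 - 2 * Real.cos θ) • fun x : Fin n => Real.cos ((x.val + 1 / 2) * θ) := by
  ext x
  rw [lapMatrix_mulVec_eq_sum_ite]
  simp only [SimpleGraph.pathGraph_adj, Pi.smul_apply, smul_eq_mul]
  rw [Fin.sum_ite_succ_or_pred x.val x.isLt
    fun y => Real.cos ((x.val + 1 / 2) * θ) - Real.cos ((y + 1 / 2) * θ)]
  have hsucc : (if x.val + 1 < n then
      Real.cos ((x.val + 1 / 2) * θ) - Real.cos (((x.val + 1 : ℕ) + 1 / 2) * θ) else 0) =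
      Real.cos ((x.val + 1 / 2) * θ) - Real.cos ((x.val + 1 / 2) * θ + θ) := by
    split_ifs with h
    · congr 2; push_cast; ring
    · have hx : (x.val : ℝ) = n - 1 := by
        rw [eq_sub_iff_add_eq]; exact_mod_cast (by omega : x.val + 1 = n)
      rw [hx, Real.cos_sub_cos,
        show (((n : ℝ) - 1 + 1 / 2) * θ + (((n : ℝ) - 1 + 1 / 2) * θ + θ)) / 2 = n * θ by ring, hθ]
      simp
  have hpred : (if 0 < x.val then
      Real.cos ((x.val + 1 / 2) * θ) - Real.cos (((x.val - 1 : ℕ) + 1 / 2) * θ) else 0) =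
      Real.cos ((x.val + 1 / 2) * θ) - Real.cos ((x.val + 1 / 2) * θ - θ) := by
    split_ifs with h
    · congr 2; rw [Nat.cast_sub (by omega)]; push_cast; ring
    · have hx : x.val = 0 := by omega
      rw [hx, ← Real.cos_neg (_ - θ)]
      ring_nf
  rw [hsucc, hpred, Real.cos_add, Real.cos_sub]
  ring

lemma lapEig_pathGraph (n : ℕ) (k : Fin n) :
    lapEig (SimpleGraph.pathGraph n) (k + 1) = 2 - 2 * Real.cos (k * Real.pi / n) := by
  have hn : (0 : ℝ) < n := by exact_mod_cast k.pos
  have hlt (j : Fin n) : (j : ℝ) * Real.pi / n < Real.pi := by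
    rw [div_lt_iff₀ hn, mul_comm]
    exact mul_lt_mul_of_pos_left (by exact_mod_cast j.isLt) Real.pi_pos
  have hmono : StrictMono fun k : Fin n => 2 - 2 * Real.cos (k * Real.pi / n) := by
    intro a b hab
    have : Real.cos (b * Real.pi / n) < Real.cos (a * Real.pi / n) := by
      refine Real.cos_lt_cos_of_nonneg_of_le_pi (by positivity) (hlt b).le ?_
      have : (a : ℝ) < b := by exact_mod_cast hab
      gcongr
    dsimp only
    linarith
  refine kthEig_eq_of_strictMono (Fintype.card_fin n) hmono (fun j => ?_) k
  have hj : (0 : ℝ) ≤ j * Real.pi / n := by positivity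
  refine isRoot_charpoly_of_mulVec_eq (fun h => ?_) (pathGraph_lapMatrix_mulVec_cos n _ ?_)
  · have h0 : Real.cos (((0 : ℕ) + 1 / 2) * (j * Real.pi / n)) = 0 := congrFun h ⟨0, k.pos⟩
    rw [Nat.cast_zero, zero_add] at h0
    exact (Real.cos_pos_of_mem_Ioo ⟨by linarith [Real.pi_pos], by linarith [hlt j]⟩).ne' h0
  · rw [mul_div_cancel₀ _ hn.ne']
    exact Real.sin_nat_mul_pi _

lemma finrank_ker_sum_proj {b : ℕ} (hb : 1 ≤ b) :
    Module.finrank ℝ (LinearMap.ker (∑ x, LinearMap.proj x : (Fin b → ℝ) →ₗ[ℝ] ℝ)) = b - 1 := by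
  have hsurj : Function.Surjective (∑ x, LinearMap.proj x : (Fin b → ℝ) →ₗ[ℝ] ℝ) := fun t =>
    ⟨Pi.single ⟨0, hb⟩ t, by simp⟩
  have h := LinearMap.finrank_range_add_finrank_ker
    (∑ x, LinearMap.proj x : (Fin b → ℝ) →ₗ[ℝ] ℝ)
  rw [LinearMap.range_eq_top.2 hsurj, finrank_top, Module.finrank_self, Module.finrank_fin_fun] at h
  omega

/-- The function on the crab graph vanishing at both centers and equal to `c x * s (j + 1)` at
distance `j + 1` from the center along the leg `x`. -/
def crabLift (b₁ b₂ r : ℕ) (s : ℕ → ℝ) :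
    ((Fin b₁ → ℝ) × (Fin b₂ → ℝ)) →ₗ[ℝ] (CrabV b₁ b₂ r → ℝ) where
  toFun c := Sum.elim (fun v => v.elim 0 fun p => c.1 p.1 * s (p.2 + 1))
    (fun v => v.elim 0 fun p => c.2 p.1 * s (p.2 + 1))
  map_add' c d := by
    ext ((_ | _) | (_ | _)) <;> simp [add_mul]
  map_smul' t c := by
    ext ((_ | _) | (_ | _)) <;> simp [mul_assoc]

lemma crabLift_injective {b₁ b₂ r : ℕ} (hr : 1 ≤ r) {s : ℕ → ℝ} (hs : s 1 ≠ 0) :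
    Function.Injective (crabLift b₁ b₂ r s) := by
  intro c d h
  ext x
  · simpa [crabLift, hs] using congrFun h (Sum.inl (some (x, ⟨0, hr⟩)))
  · simpa [crabLift, hs] using congrFun h (Sum.inr (some (x, ⟨0, hr⟩)))

/-- The Laplacian of a leg, with Dirichlet condition at the center and free outer end. -/
lemma leg_sum_eq {r : ℕ} {s : ℕ → ℝ} {μ : ℝ} (hs0 : s 0 = 0) (hsr : s (r + 1) = s r)
    (hs : ∀ m, 2 * s (m + 1) - s m - s (m + 2) = μ * s (m + 1)) (a : ℝ) (j : Fin r) :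
    (if j.val = 0 then a * s (j + 1) else 0) +
      (∑ y : Fin r, if j.val + 1 = y.val ∨ y.val + 1 = j.val then
        a * s (j + 1) - a * s (y + 1) else 0) = μ * (a * s (j + 1)) := by
  rw [Fin.sum_ite_succ_or_pred j.val j.isLt fun y => a * s (j + 1) - a * s (y + 1)]
  have hsucc : (if j.val + 1 < r then a * s (j + 1) - a * s (j + 1 + 1) else 0) =
      a * s (j + 1) - a * s (j + 2) := by
    split_ifs with h
    · rfl
    · have hj : j.val + 1 = r := by omega
      rw [show j.val + 2 = j + 1 + 1 from rfl, hj, hsr, sub_self]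
  have hpred : (if j.val = 0 then a * s (j + 1) else 0) +
      (if 0 < j.val then a * s (j + 1) - a * s (j - 1 + 1) else 0) =
      a * s (j + 1) - a * s j := by
    rcases Nat.eq_zero_or_pos j.val with h | h
    · simp [h, hs0]
    · rw [Nat.sub_add_cancel h, if_neg h.ne', if_pos h, zero_add]
  linear_combination hsucc + hpred + a * hs j

lemma sum_prod_ite_fst_eq {b r : ℕ} (x : Fin b) (p : Fin r → Prop)
    [DecidablePred p] (g : Fin b → Fin r → ℝ) :
    (∑ x', ∑ y, if x = x' ∧ p y then g x' y else 0) = ∑ y, if p y then g x y else 0 := by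
  rw [Finset.sum_eq_single x]
  · simp
  · intro x' _ hx'
    simp [hx'.symm]
  · simp

/-- The neighbors of a center contribute nothing when the values sum to zero over the legs. -/
lemma sum_first_vertices_eq_zero {b r : ℕ} {c : Fin b → ℝ} (hc : ∑ x, c x = 0) (s : ℕ → ℝ) :
    (∑ x, ∑ y : Fin r, if y.val = 0 then -(c x * s (y + 1)) else 0) = 0 := by
  rw [Finset.sum_comm]
  refine Finset.sum_eq_zero fun y _ => ?_
  split_ifs
  · rw [Finset.sum_neg_distrib, ← Finset.sum_mul, hc, zero_mul, neg_zero]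
  · exact Finset.sum_const_zero

lemma crab_leg_adj_iff {b r : ℕ} {x x' : Fin b} {j y : Fin r} :
    ((x = x' → ¬j = y) ∧ (x = x' ∧ y.val = j.val + 1 ∨ x' = x ∧ j.val = y.val + 1)) ↔
      (x = x' ∧ (j.val + 1 = y.val ∨ y.val + 1 = j.val)) := by
  rw [Fin.ext_iff (a := j)]
  constructor
  · rintro ⟨_, h | h⟩
    · exact ⟨h.1, Or.inl h.2.symm⟩
    · exact ⟨h.1.symm, Or.inr h.2.symm⟩
  · rintro ⟨rfl, h⟩
    refine ⟨fun _ => by omega, ?_⟩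
    simpa [eq_comm] using h

lemma crabLift_lapMatrix_mulVec {b₁ b₂ r : ℕ} {s : ℕ → ℝ} {μ : ℝ} (hs0 : s 0 = 0)
    (hsr : s (r + 1) = s r) (hs : ∀ m, 2 * s (m + 1) - s m - s (m + 2) = μ * s (m + 1))
    {c : (Fin b₁ → ℝ) × (Fin b₂ → ℝ)} (hc₁ : ∑ x, c.1 x = 0) (hc₂ : ∑ x, c.2 x = 0) :
    ((crab b₁ b₂ r).lapMatrix ℝ).mulVec (crabLift b₁ b₂ r s c) = μ • crabLift b₁ b₂ r s c := by
  ext v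
  rw [lapMatrix_mulVec_eq_sum_ite, Fintype.sum_sum_type, Fintype.sum_option, Fintype.sum_option,
    Fintype.sum_prod_type, Fintype.sum_prod_type]
  rcases v with (_ | ⟨x, j⟩) | (_ | ⟨x, j⟩)
  · simpa [crab, crabRel, crabLift] using sum_first_vertices_eq_zero hc₁ s
  · have h := leg_sum_eq hs0 hsr hs (c.1 x) j
    rw [← sum_prod_ite_fst_eq x _ fun x' y => c.1 x * s (j + 1) - c.1 x' * s (y + 1)] at h
    simpa [crab, crabRel, crabLift, crab_leg_adj_iff] using h
  · simpa [crab, crabRel, crabLift] using sum_first_vertices_eq_zero hc₂ s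
  · have h := leg_sum_eq hs0 hsr hs (c.2 x) j
    rw [← sum_prod_ite_fst_eq x _ fun x' y => c.2 x * s (j + 1) - c.2 x' * s (y + 1)] at h
    simpa [crab, crabRel, crabLift, crab_leg_adj_iff] using h

/-- **Lemma (lifted path eigenvalues of the crab graph).**
Let `λ = λ_{2i}(P_{2r+1})` with `1 ≤ i ≤ r`.  Then the `λ`-eigenspace of the Laplacian of
`CG_{b₁,b₂;r}` contains a subspace of dimension `b₁ + b₂ − 2` consisting of functions
summing to zero on each part of the natural equitable partition (the two centers, and the
sets of vertices at each fixed distance `1 ≤ j ≤ r` from each center along the legs). -/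
theorem crab_lifted_path_eigenvalues
    (b₁ b₂ r i : ℕ) (hb₁ : 1 ≤ b₁) (hb₂ : 1 ≤ b₂) (hr : 1 ≤ r)
    (hi1 : 1 ≤ i) (hi2 : i ≤ r) :
    ∃ W : Submodule ℝ (CrabV b₁ b₂ r → ℝ),
      Module.finrank ℝ W = b₁ + b₂ - 2 ∧
      W ≤ Module.End.eigenspace
            (Matrix.mulVecLin (SimpleGraph.lapMatrix ℝ (crab b₁ b₂ r)))
            (lapEig (SimpleGraph.pathGraph (2 * r + 1)) (2 * i)) ∧
      (∀ f ∈ W,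
        f (Sum.inl none) = 0 ∧ f (Sum.inr none) = 0 ∧
        (∀ j : Fin r, (∑ x : Fin b₁, f (Sum.inl (some (x, j)))) = 0) ∧
        (∀ j : Fin r, (∑ x : Fin b₂, f (Sum.inr (some (x, j)))) = 0)) := by
  obtain ⟨k, hk⟩ : ∃ k : Fin (2 * r + 1), k.val + 1 = 2 * i :=
    ⟨⟨2 * i - 1, by omega⟩, by dsimp only; omega⟩
  have hk' : (k : ℝ) = 2 * i - 1 := by
    rw [eq_sub_iff_add_eq]
    exact_mod_cast hk
  rw [← hk, lapEig_pathGraph]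
  set θ : ℝ := k * Real.pi / (2 * r + 1 : ℕ) with hθ
  have hθr : (2 * r + 1) * θ = (2 * i - 1) * Real.pi := by
    rw [hθ, hk']
    push_cast
    field_simp
  have hi : (1 : ℝ) ≤ i := by exact_mod_cast hi1
  have hir : (i : ℝ) ≤ r := by exact_mod_cast hi2
  have hθ0 : 0 < θ := by
    have : 0 < (2 * (r : ℝ) + 1) * θ := hθr ▸ mul_pos (by linarith) Real.pi_pos
    exact pos_of_mul_pos_right this (by positivity)
  have hθπ : θ < Real.pi := by
    refine lt_of_mul_lt_mul_left (a := 2 * (r : ℝ) + 1) ?_ (by positivity)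
    rw [hθr]
    exact mul_lt_mul_of_pos_right (by linarith) Real.pi_pos
  set s : ℕ → ℝ := fun m => Real.sin (m * θ)
  have hs0 : s 0 = 0 := by simp [s]
  have hs1 : s 1 ≠ 0 := by
    simpa [s] using (Real.sin_pos_of_pos_of_lt_pi hθ0 hθπ).ne'
  have hsr : s (r + 1) = s r := by
    rw [← sub_eq_zero]
    simp only [s]
    rw [Real.sin_sub_sin,
      show (((r + 1 : ℕ) : ℝ) * θ + r * θ) / 2 = i * Real.pi - Real.pi / 2 by
        push_cast; linear_combination hθr / 2,
      Real.cos_sub_pi_div_two, Real.sin_nat_mul_pi, mul_zero]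
  have hs (m : ℕ) : 2 * s (m + 1) - s m - s (m + 2) = (2 - 2 * Real.cos θ) * s (m + 1) := by
    simp only [s]
    rw [show (m : ℝ) * θ = (m + 1 : ℕ) * θ - θ by push_cast; ring,
      show ((m + 2 : ℕ) : ℝ) * θ = (m + 1 : ℕ) * θ + θ by push_cast; ring,
      Real.sin_sub, Real.sin_add]
    ring
  refine ⟨LinearMap.range ((crabLift b₁ b₂ r s).comp
    ((LinearMap.ker (∑ x, LinearMap.proj x : (Fin b₁ → ℝ) →ₗ[ℝ] ℝ)).subtype.prodMap
      (LinearMap.ker (∑ x, LinearMap.proj x : (Fin b₂ → ℝ) →ₗ[ℝ] ℝ)).subtype)), ?_, ?_, ?_⟩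
  · rw [LinearMap.finrank_range_of_inj, Module.finrank_prod, finrank_ker_sum_proj hb₁,
      finrank_ker_sum_proj hb₂]
    · omega
    · exact (crabLift_injective hr hs1).comp
        (Subtype.val_injective.prodMap Subtype.val_injective)
  · rintro _ ⟨⟨⟨c₁, hc₁⟩, ⟨c₂, hc₂⟩⟩, rfl⟩
    rw [Module.End.mem_eigenspace_iff]
    exact crabLift_lapMatrix_mulVec hs0 hsr hs (by simpa using hc₁) (by simpa using hc₂)
  · rintro _ ⟨⟨⟨c₁, hc₁⟩, ⟨c₂, hc₂⟩⟩, rfl⟩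
    have hc₁' : ∑ x, c₁ x = 0 := by simpa using hc₁
    have hc₂' : ∑ x, c₂ x = 0 := by simpa using hc₂
    simp [crabLift, ← Finset.sum_mul, hc₁', hc₂']

end
end

section
/- Let b ≥ 3 and r ≥ 1 be integers. Then the algebraic connectivity of the crab graph CG_{1,b−1;r} satisfies λ2(CG_{1,b−1;r}) > λ2(P_{2r+3}). -/
open scoped Classical

noncomputable section

open Matrix in
theorem lapMatrix_mulVec_eq_sum {V : Type*} [Fintype V] (G : SimpleGraph V) (f : V → ℝ) (x : V)
    (s : Finset V) (hs : ∀ y, G.Adj x y ↔ y ∈ s) :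
    (G.lapMatrix ℝ *ᵥ f) x = ∑ y ∈ s, (f x - f y) := by
  have : G.neighborFinset x = s := by ext y; simp [hs]
  rw [SimpleGraph.lapMatrix_mulVec_apply, ← SimpleGraph.card_neighborFinset_eq_degree, this]
  simp

/-- `f` satisfies the Laplacian eigenvalue equation of `G` for `ν` at every vertex. -/
def IsLapEigenfunction {V : Type*} (G : SimpleGraph V) (ν : ℝ) (f : V → ℝ) : Prop :=
  ∀ x (s : Finset V), (∀ y, G.Adj x y ↔ y ∈ s) → ∑ y ∈ s, (f x - f y) = ν * f x

open Matrix in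
/-- A positive Laplacian eigenvalue is an upper bound for the algebraic connectivity. -/
theorem lapEig_two_le_of_mulVec_eq {V : Type*} [Fintype V] (G : SimpleGraph V) {μ : ℝ}
    (hμ : 0 < μ) {f : V → ℝ} (hf : f ≠ 0)
    (h : ∀ x, ∃ s : Finset V, (∀ y, G.Adj x y ↔ y ∈ s) ∧ ∑ y ∈ s, (f x - f y) = μ * f x) :
    lapEig G 2 ≤ μ := by
  have hroot : ∀ (ν : ℝ) (g : V → ℝ), g ≠ 0 → G.lapMatrix ℝ *ᵥ g = ν • g →
      ν ∈ (G.lapMatrix ℝ).charpoly.roots.sort (· ≤ ·) := by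
    intro ν g hg hν
    rw [Multiset.mem_sort, Polynomial.mem_roots (charpoly_monic _).ne_zero,
      Polynomial.IsRoot, eval_charpoly, ← exists_mulVec_eq_zero_iff]
    refine ⟨g, hg, ?_⟩
    rw [sub_mulVec, hν]
    ext x
    simp [scalar_apply]
  obtain ⟨x, -⟩ := Function.ne_iff.1 hf
  obtain ⟨i, hi, hi'⟩ := List.mem_iff_getElem.1 <| hroot 0 (fun _ ↦ 1)
    (fun h0 ↦ one_ne_zero (congrFun h0 x)) (by
      rw [zero_smul]; exact G.lapMatrix_mulVec_const_eq_zero)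
  obtain ⟨j, hj, hj'⟩ := List.mem_iff_getElem.1 <| hroot μ f hf (by
    ext x
    obtain ⟨s, hs, hsum⟩ := h x
    rw [lapMatrix_mulVec_eq_sum G f x s hs, hsum, Pi.smul_apply, smul_eq_mul])
  have hs := ((G.lapMatrix ℝ).charpoly.roots.pairwise_sort (· ≤ ·)).sortedLE
  have hij : i < j := by
    by_contra! hji
    have := hs.getElem_le_getElem_of_le (hi := hj) (hj := hi) hji
    linarith
  have h1 := hs.getElem_le_getElem_of_le (i := 1) (j := j) (hi := by omega) (hj := hj) (by omega)
  rw [lapEig, kthEig, List.getD_eq_getElem _ _ (by omega)]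
  exact h1.trans_eq hj'

open Matrix in
/-- If all Laplacian eigenvectors with eigenvalue at most `μ` have a strict sign,
then the algebraic connectivity exceeds `μ`. -/
theorem lt_lapEig_two_of_forall_eigenvector {V : Type*} [Fintype V] (G : SimpleGraph V)
    (hV : 1 < Fintype.card V) {μ : ℝ} (v : V)
    (h : ∀ (ν : ℝ) (f : V → ℝ), 0 ≤ ν → ν ≤ μ → f ≠ 0 → IsLapEigenfunction G ν f →
      ∀ x, 0 < f x * f v) :
    μ < lapEig G 2 := by
  have hA := SimpleGraph.isHermitian_lapMatrix ℝ G
  by_contra! hle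
  have hroots := hA.roots_charpoly_eq_eigenvalues
  have hlen : ((G.lapMatrix ℝ).charpoly.roots.sort (· ≤ ·)).length = Fintype.card V := by
    rw [Multiset.length_sort, hroots]; simp
  have hs := ((G.lapMatrix ℝ).charpoly.roots.pairwise_sort (· ≤ ·)).sortedLE
  have hcoe := (G.lapMatrix ℝ).charpoly.roots.sort_eq (· ≤ ·)
  rw [lapEig, kthEig] at hle
  generalize (G.lapMatrix ℝ).charpoly.roots.sort (· ≤ ·) = l at hlen hs hcoe hle
  have hcount : 1 < (Finset.univ.filter fun i ↦ hA.eigenvalues i ≤ μ).card := by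
    have h2 : 1 < Multiset.countP (· ≤ μ) (l : Multiset ℝ) := by
      match l, hle, hs, hlen with
      | [], _, _, h0 => simp at h0; omega
      | [_], _, _, h0 => simp at h0; omega
      | a :: c :: t, hc, hs, _ =>
        have hac : a ≤ c :=
          hs.getElem_le_getElem_of_le (i := 0) (j := 1) (hi := by simp) (hj := by simp) (by simp)
        have hc' : c ≤ μ := hc
        simp [hc', hac.trans hc']
    rw [hcoe, hroots, Multiset.countP_map] at h2
    exact h2
  obtain ⟨i, hi, j, hj, hij⟩ := Finset.one_lt_card.1 hcount
  have hpos : ∀ i, hA.eigenvalues i ≤ μ → ∀ x,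
      0 < hA.eigenvectorBasis i x * hA.eigenvectorBasis i v := by
    intro i hi
    refine h _ _ ((SimpleGraph.posSemidef_lapMatrix ℝ G).eigenvalues_nonneg i) hi ?_ ?_
    swap
    · intro x s hs
      rw [← lapMatrix_mulVec_eq_sum G _ x s hs, hA.mulVec_eigenvectorBasis i, Pi.smul_apply,
        smul_eq_mul]
    intro h0
    refine hA.eigenvectorBasis.orthonormal.ne_zero i ?_
    ext x
    exact congrFun h0 x
  have horth : inner ℝ (hA.eigenvectorBasis i) (hA.eigenvectorBasis j) = 0 :=
    hA.eigenvectorBasis.orthonormal.2 hij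
  rw [PiLp.inner_apply] at horth
  have hsum : 0 < ∑ x, (hA.eigenvectorBasis i x * hA.eigenvectorBasis i v) *
      (hA.eigenvectorBasis j x * hA.eigenvectorBasis j v) :=
    Finset.sum_pos (fun x _ ↦ mul_pos (hpos i (by simpa using hi) x) (hpos j (by simpa using hj) x))
      ⟨v, Finset.mem_univ v⟩
  have : ∑ x, (hA.eigenvectorBasis i x * hA.eigenvectorBasis i v) *
      (hA.eigenvectorBasis j x * hA.eigenvectorBasis j v) =
      (hA.eigenvectorBasis i v * hA.eigenvectorBasis j v) *
        ∑ x, inner ℝ (hA.eigenvectorBasis i x) (hA.eigenvectorBasis j x) := by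
    rw [Finset.mul_sum]
    refine Finset.sum_congr rfl fun x _ ↦ ?_
    simp only [RCLike.inner_apply, conj_trivial]
    ring
  rw [this, horth, mul_zero] at hsum
  exact hsum.false

/-- Along a pendant path `P 0, …, P n` starting at a leaf, a Laplacian eigenvector is a cosine. -/
theorem eigenvector_pendant_path {V : Type*} (G : SimpleGraph V) {θ : ℝ}
    {f : V → ℝ} (hf : IsLapEigenfunction G (2 - 2 * Real.cos θ) f) (P : ℕ → V) (n : ℕ)
    (h0 : 0 < n → ∀ y, G.Adj (P 0) y ↔ y = P 1)
    (hadj : ∀ k, k + 1 < n → ∀ y, G.Adj (P (k + 1)) y ↔ y = P k ∨ y = P (k + 2))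
    (hne : ∀ k, k + 1 < n → P k ≠ P (k + 2)) :
    ∀ k ≤ n, f (P k) * Real.cos (θ / 2) = f (P 0) * Real.cos ((k + 1 / 2) * θ) := by
  have hcos : Real.cos θ = 2 * Real.cos (θ / 2) ^ 2 - 1 := by
    rw [← Real.cos_two_mul]; ring_nf
  have hstep : ∀ t : ℝ, Real.cos (t + θ) = 2 * Real.cos θ * Real.cos t - Real.cos (t - θ) := by
    intro t; rw [Real.cos_add, Real.cos_sub]; ring
  intro k
  induction k using Nat.twoStepInduction with
  | zero => intro _; congr 2; push_cast; ring
  | one =>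
    intro hn
    have h := hf (P 0) {P 1} (by simpa using h0 (by omega))
    rw [Finset.sum_singleton] at h
    have h3 : Real.cos ((((1 : ℕ) : ℝ) + 1 / 2) * θ) =
        2 * Real.cos θ * Real.cos (θ / 2) - Real.cos (θ / 2) := by
      rw [← Real.cos_neg (θ / 2)]
      convert hstep (θ / 2) using 2
      · push_cast; ring
      · rw [Real.cos_neg]
      · ring_nf
    rw [h3]
    linear_combination (-Real.cos (θ / 2)) * h
  | more k ih1 ih2 =>
    intro hn
    have h := hf (P (k + 1)) {P k, P (k + 2)} (by simpa using hadj k (by omega))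
    rw [Finset.sum_pair (hne k (by omega))] at h
    have h3 := hstep ((((k + 1 : ℕ) : ℝ) + 1 / 2) * θ)
    have e1 : (((k + 1 : ℕ) : ℝ) + 1 / 2) * θ + θ = (((k + 2 : ℕ) : ℝ) + 1 / 2) * θ := by
      push_cast; ring
    have e2 : (((k + 1 : ℕ) : ℝ) + 1 / 2) * θ - θ = ((k : ℝ) + 1 / 2) * θ := by
      push_cast; ring
    rw [e1, e2] at h3
    rw [h3]
    linear_combination (-Real.cos (θ / 2)) * h + 2 * Real.cos θ * ih2 (by omega) - ih1 (by omega)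

theorem lapEig_two_pathGraph_le (n : ℕ) :
    lapEig (SimpleGraph.pathGraph (n + 2)) 2 ≤ 2 - 2 * Real.cos (Real.pi / (n + 2)) := by
  set θ := Real.pi / (n + 2) with hθ
  have hθ0 : 0 < θ := by positivity
  have hn : (n + 2) * θ = Real.pi := by rw [hθ]; field_simp
  have hθπ : θ ≤ Real.pi / 2 := by
    have : (0 : ℝ) ≤ n := n.cast_nonneg
    nlinarith
  have hstep : ∀ t : ℝ, Real.cos (t + θ) = 2 * Real.cos θ * Real.cos t - Real.cos (t - θ) := by
    intro t; rw [Real.cos_add, Real.cos_sub]; ring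
  refine lapEig_two_le_of_mulVec_eq _ (f := fun j ↦ Real.cos ((j.val + 1 / 2) * θ)) ?_ ?_ ?_
  · have := Real.cos_lt_cos_of_nonneg_of_le_pi_div_two le_rfl hθπ hθ0
    rw [Real.cos_zero] at this
    linarith
  · intro h0
    have h1 := congrFun h0 0
    have : 0 < Real.cos (1 / 2 * θ) :=
      Real.cos_pos_of_mem_Ioo ⟨by linarith, by linarith [Real.pi_pos]⟩
    simp at h1 this
    linarith
  · rintro ⟨j, hj⟩
    have hs := hstep ((j + 1 / 2) * θ)
    rcases Nat.eq_zero_or_pos j with rfl | hj0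
    · refine ⟨{⟨1, by omega⟩}, ?_, ?_⟩
      swap
      · have e1 : ((0 : ℕ) + 1 / 2) * θ - θ = -(((0 : ℕ) + 1 / 2) * θ) := by push_cast; ring
        have e2 : ((0 : ℕ) + 1 / 2) * θ + θ = ((1 : ℕ) + 1 / 2) * θ := by push_cast; ring
        rw [e1, Real.cos_neg, e2] at hs
        rw [Finset.sum_singleton]
        linear_combination -hs
      · rintro ⟨y, hy⟩
        simp [SimpleGraph.pathGraph_adj]; omega
    · have e1 : (j + 1 / 2) * θ - θ = ((j - 1 : ℕ) + 1 / 2) * θ := by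
        push_cast [Nat.cast_sub hj0]; ring
      rcases Nat.lt_or_ge (j + 1) (n + 2) with hj1 | hj1
      · refine ⟨{⟨j - 1, by omega⟩, ⟨j + 1, by omega⟩}, ?_, ?_⟩
        swap
        · have e2 : (j + 1 / 2) * θ + θ = ((j + 1 : ℕ) + 1 / 2) * θ := by push_cast; ring
          rw [e1, e2] at hs
          rw [Finset.sum_pair (by simp)]
          linear_combination -hs
        · rintro ⟨y, hy⟩
          simp [SimpleGraph.pathGraph_adj]; omega
      · obtain rfl : j = n + 1 := by omega
        refine ⟨{⟨n, by omega⟩}, ?_, ?_⟩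
        swap
        · have e2 : ((n + 1 : ℕ) + 1 / 2) * θ + θ =
              2 * Real.pi - ((n + 1 : ℕ) + 1 / 2) * θ := by
            push_cast; linear_combination 2 * hn
          rw [e1, e2, Real.cos_two_pi_sub] at hs
          rw [Finset.sum_singleton]
          simp only [Nat.add_sub_cancel] at hs
          linear_combination -hs
        · rintro ⟨y, hy⟩
          simp [SimpleGraph.pathGraph_adj]; omega

/-- The short legs of `crab b₁ b₂ r`, indexed from the leaf up to the second center. -/
def crabShortLeg (b₁ : ℕ) {b₂ r : ℕ} (i : Fin b₂) (k : ℕ) : CrabV b₁ b₂ r :=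
  if h : k < r then Sum.inr (some (i, ⟨r - 1 - k, by omega⟩)) else Sum.inr none

/-- The path in `crab 1 b₂ r` from the leaf of the single leg at the first center
up to the second center. -/
def crabLongLeg (b₂ r : ℕ) (k : ℕ) : CrabV 1 b₂ r :=
  if h : k < r then Sum.inl (some (0, ⟨r - 1 - k, by omega⟩))
  else if k = r then Sum.inl none else Sum.inr none

theorem crab_adj_shortLeg_zero {b r : ℕ} (i : Fin b) (hr : 0 < r) (y : CrabV 1 b r) :
    (crab 1 b r).Adj (crabShortLeg 1 i 0) y ↔ y = crabShortLeg 1 i 1 := by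
  rcases y with (_ | ⟨i', j, hj⟩) | (_ | ⟨i', j, hj⟩) <;> rcases Nat.lt_or_ge 1 r with h | h <;>
    simp [crab, crabRel, crabShortLeg, hr, h, h.not_gt] <;> omega

theorem crab_adj_shortLeg_succ {b r : ℕ} (i : Fin b) (k : ℕ) (hk : k + 1 < r) (y : CrabV 1 b r) :
    (crab 1 b r).Adj (crabShortLeg 1 i (k + 1)) y ↔
      y = crabShortLeg 1 i k ∨ y = crabShortLeg 1 i (k + 2) := by
  have hk' : k < r := by omega
  rcases y with (_ | ⟨i', j, hj⟩) | (_ | ⟨i', j, hj⟩) <;>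
    rcases Nat.lt_or_ge (k + 2) r with h | h <;>
    simp [crab, crabRel, crabShortLeg, hk, hk', h, h.not_gt] <;> omega

theorem crabShortLeg_ne {b r : ℕ} (i : Fin b) (k : ℕ) (hk : k + 1 < r) :
    (crabShortLeg 1 i k : CrabV 1 b r) ≠ crabShortLeg 1 i (k + 2) := by
  have hk' : k < r := by omega
  rcases Nat.lt_or_ge (k + 2) r with h | h <;>
    simp [crabShortLeg, hk', h, h.not_gt]
  omega

theorem crab_adj_longLeg_zero (b r : ℕ) (_ : 0 < r + 1) (y : CrabV 1 b r) :
    (crab 1 b r).Adj (crabLongLeg b r 0) y ↔ y = crabLongLeg b r 1 := by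
  obtain rfl | rfl | h : r = 0 ∨ r = 1 ∨ 1 < r := by omega
  · rcases y with (_ | ⟨i', j, hj⟩) | (_ | ⟨i', j, hj⟩) <;> simp [crab, crabRel, crabLongLeg]
    all_goals omega
  · rcases y with (_ | ⟨i', j, hj⟩) | (_ | ⟨i', j, hj⟩) <;> simp [crab, crabRel, crabLongLeg]
    all_goals omega
  · have hr : 0 < r := by omega
    rcases y with (_ | ⟨i', j, hj⟩) | (_ | ⟨i', j, hj⟩) <;>
      simp [crab, crabRel, crabLongLeg, h, hr, Fin.eq_zero] <;> omega

theorem crab_adj_longLeg_succ (b r : ℕ) (k : ℕ) (hk : k + 1 < r + 1) (y : CrabV 1 b r) :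
    (crab 1 b r).Adj (crabLongLeg b r (k + 1)) y ↔
      y = crabLongLeg b r k ∨ y = crabLongLeg b r (k + 2) := by
  have hk' : k < r := by omega
  obtain rfl | rfl | h : r = k + 1 ∨ r = k + 2 ∨ k + 2 < r := by omega
  · rcases y with (_ | ⟨i', j, hj⟩) | (_ | ⟨i', j, hj⟩) <;>
      simp [crab, crabRel, crabLongLeg, Fin.eq_zero]
  · rcases y with (_ | ⟨i', j, hj⟩) | (_ | ⟨i', j, hj⟩) <;>
      simp [crab, crabRel, crabLongLeg, Fin.eq_zero]
    omega
  · have hk1 : k + 1 < r := by omega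
    rcases y with (_ | ⟨i', j, hj⟩) | (_ | ⟨i', j, hj⟩) <;>
      simp [crab, crabRel, crabLongLeg, hk', hk1, h, Fin.eq_zero] <;> omega

theorem crabLongLeg_ne (b r : ℕ) (k : ℕ) (hk : k + 1 < r + 1) :
    crabLongLeg b r k ≠ crabLongLeg b r (k + 2) := by
  have hk' : k < r := by omega
  simp only [crabLongLeg, hk', dite_true]
  split_ifs <;> simp
  omega

theorem crab_eigenvector_mul_center_pos (b r : ℕ) {θ : ℝ} (hθ0 : 0 ≤ θ)
    (hθ : θ ≤ Real.pi / (2 * r + 3)) {f : CrabV 1 b r → ℝ} (hf0 : f ≠ 0)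
    (hf : IsLapEigenfunction (crab 1 b r) (2 - 2 * Real.cos θ) f) (x : CrabV 1 b r) :
    0 < f x * f (Sum.inr none) := by
  rw [le_div_iff₀ (by positivity)] at hθ
  have hc : ∀ k ≤ r, 0 < Real.cos ((k + 1 / 2) * θ) := by
    intro k hk
    have hk' : (k : ℝ) ≤ r := by exact_mod_cast hk
    have := mul_le_mul_of_nonneg_right hk' hθ0
    have hk0 : 0 ≤ (k : ℝ) * θ := by positivity
    rcases hθ0.eq_or_lt with h | h
    · simp [← h]
    · exact Real.cos_pos_of_mem_Ioo ⟨by linarith [Real.pi_pos], by linarith⟩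
  have hc1 : 0 ≤ Real.cos (((r + 1 : ℕ) + 1 / 2) * θ) := by
    have hk0 : 0 ≤ (r : ℝ) * θ := by positivity
    push_cast
    exact Real.cos_nonneg_of_mem_Icc ⟨by linarith [Real.pi_pos], by linarith⟩
  have hhalf : 0 < Real.cos (θ / 2) := by
    convert hc 0 (Nat.zero_le r) using 2; push_cast; ring
  have hshort : ∀ (i : Fin b), ∀ k ≤ r, f (crabShortLeg 1 i k) * Real.cos (θ / 2) =
      f (crabShortLeg 1 i 0) * Real.cos ((k + 1 / 2) * θ) := by
    intro i
    exact eigenvector_pendant_path _ hf _ r (crab_adj_shortLeg_zero i) (crab_adj_shortLeg_succ i)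
      (crabShortLeg_ne i)
  have hlong : ∀ k ≤ r + 1, f (crabLongLeg b r k) * Real.cos (θ / 2) =
      f (crabLongLeg b r 0) * Real.cos ((k + 1 / 2) * θ) := by
    exact eigenvector_pendant_path _ hf _ (r + 1) (crab_adj_longLeg_zero b r)
      (crab_adj_longLeg_succ b r) (crabLongLeg_ne b r)
  have hcover : ∀ y, (∃ i, ∃ k ≤ r, y = crabShortLeg 1 i k) ∨
      (∃ k ≤ r, y = crabLongLeg b r k) ∨ y = Sum.inr none := by
    rintro ((_ | ⟨i, j, hj⟩) | (_ | ⟨i, j, hj⟩))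
    · exact .inr (.inl ⟨r, le_rfl, by simp [crabLongLeg]⟩)
    · refine .inr (.inl ⟨r - 1 - j, by omega, ?_⟩)
      rw [crabLongLeg, dif_pos (by omega)]
      simp; omega
    · exact .inr (.inr rfl)
    · refine .inl ⟨i, r - 1 - j, by omega, ?_⟩
      rw [crabShortLeg, dif_pos (by omega)]
      simp; omega
  have hsr : ∀ i : Fin b, crabShortLeg 1 (r := r) i r = Sum.inr none := by
    simp [crabShortLeg]
  have hlr : crabLongLeg b r r = Sum.inl none := by simp [crabLongLeg]
  have hlr1 : crabLongLeg b r (r + 1) = Sum.inr none := by simp [crabLongLeg]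
  have hv : f (Sum.inr none) ≠ 0 := by
    intro hv
    have hs0 : ∀ z, f (Sum.inr z) = 0 := by
      intro z
      rcases hcover (Sum.inr z) with ⟨i, k, hk, hz⟩ | ⟨k, hk, hz⟩ | hz
      · have hr0 := hshort i r le_rfl
        rw [hsr, hv, zero_mul, eq_comm] at hr0
        have := hshort i k hk
        rw [(mul_eq_zero.1 hr0).resolve_right (hc r le_rfl).ne', zero_mul, ← hz] at this
        exact (mul_eq_zero.1 this).resolve_right hhalf.ne'
      · rw [crabLongLeg] at hz
        split_ifs at hz
        omega
      · rw [hz, hv]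
    have hu : f (Sum.inl none) = 0 := by
      have h := hf (Sum.inr none) (Finset.univ.filter ((crab 1 b r).Adj (Sum.inr none))) (by simp)
      rw [Finset.sum_eq_single (Sum.inl none)] at h
      · simpa [hv] using h
      · rintro ((_ | z) | z) hy hne
        · exact absurd rfl hne
        · have hadj := (Finset.mem_filter.1 hy).2
          simp [crab, crabRel] at hadj
        · rw [hs0, hs0, sub_zero]
      · intro hn
        exact absurd (Finset.mem_filter.2 ⟨Finset.mem_univ _, by simp [crab, crabRel]⟩) hn
    have hl := hlong r (by omega)
    rw [hlr, hu, zero_mul, eq_comm] at hl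
    have hl0 := (mul_eq_zero.1 hl).resolve_right (hc r le_rfl).ne'
    refine hf0 (funext fun y ↦ ?_)
    rcases hcover y with ⟨i, k, hk, rfl⟩ | ⟨k, hk, rfl⟩ | rfl
    · rw [crabShortLeg]
      split_ifs <;> exact hs0 _
    · have := hlong k (by omega)
      rw [hl0, zero_mul] at this
      exact (mul_eq_zero.1 this).resolve_right hhalf.ne'
    · exact hv
  have key : ∀ a d c₁ c₂ w : ℝ, w ≠ 0 → 0 < c₁ → 0 ≤ c₂ → a * Real.cos (θ / 2) = d * c₁ →
      w * Real.cos (θ / 2) = d * c₂ → 0 < a * w := by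
    intro a d c₁ c₂ w hw h1 h2 ha hw'
    have hne : d * c₂ ≠ 0 := hw' ▸ mul_ne_zero hw hhalf.ne'
    have hd := left_ne_zero_of_mul hne
    have h2' := h2.lt_of_ne' (right_ne_zero_of_mul hne)
    have : 0 < (a * w) * (Real.cos (θ / 2) * Real.cos (θ / 2)) := by
      have e : (a * w) * (Real.cos (θ / 2) * Real.cos (θ / 2)) = (d * d) * (c₁ * c₂) := by
        linear_combination (w * Real.cos (θ / 2)) * ha + d * c₁ * hw'
      rw [e]
      exact mul_pos (mul_self_pos.2 hd) (mul_pos h1 h2')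
    exact pos_of_mul_pos_left this (by positivity)
  rcases hcover x with ⟨i, k, hk, rfl⟩ | ⟨k, hk, rfl⟩ | rfl
  · exact key _ _ _ _ _ hv (hc k hk) (hc r le_rfl).le (hshort i k hk) (hsr i ▸ hshort i r le_rfl)
  · exact key _ _ _ _ _ hv (hc k hk) hc1 (hlong k (by omega)) (hlr1 ▸ hlong (r + 1) le_rfl)
  · exact mul_self_pos.2 hv

/-- **Lemma.** For `b ≥ 3`, `r ≥ 1`, `λ₂(CG_{1,b−1;r}) > λ₂(P_{2r+3})`. -/
theorem algebraic_connectivity_crab_gt_path (b r : ℕ) (hb : 3 ≤ b) (hr : 1 ≤ r) :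
    lapEig (SimpleGraph.pathGraph (2 * r + 3)) 2 < lapEig (crab 1 (b - 1) r) 2 := by
  refine (lapEig_two_pathGraph_le (2 * r + 1)).trans_lt ?_
  refine lt_lapEig_two_of_forall_eigenvector _ ?_ (Sum.inr none) ?_
  · exact Fintype.one_lt_card_iff.2 ⟨Sum.inl none, Sum.inr none, by simp⟩
  · intro ν f hν0 hν hf0 hf x
    have e : ((2 * r + 1 : ℕ) : ℝ) + 2 = 2 * r + 3 := by push_cast; ring
    rw [e] at hν
    have hcos : Real.cos (Real.arccos (1 - ν / 2)) = 1 - ν / 2 :=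
      Real.cos_arccos (by linarith [Real.neg_one_le_cos (Real.pi / (2 * r + 3))]) (by linarith)
    refine crab_eigenvector_mul_center_pos (b - 1) r (θ := Real.arccos (1 - ν / 2))
      (Real.arccos_nonneg _) ?_ hf0 ?_ x
    · have hπ : Real.pi / (2 * r + 3) ≤ Real.pi := div_le_self Real.pi_pos.le (by
        have : (0 : ℝ) ≤ r := r.cast_nonneg
        linarith)
      rw [← Real.arccos_cos (x := Real.pi / (2 * r + 3)) (by positivity) hπ]
      exact Real.arccos_le_arccos (by linarith)
    · rw [hcos]; convert hf using 1; ring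

end
end
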